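/- Let N = 2, let q ∈ ℂ* be not a root of unity (or q = 1), and let ξ = diag(ξ₁, ξ₂). (i') If ξ₁ − q^{-2k}ξ₂ ≠ 0 for all k = 1, 2, …, then the image of α^ξ is O(D\GL_q), and the kernel of α^ξ is the left ideal O(M_q)·(σ₁ − σ₁(ξ)) + O(M_q)·(σ₂ − σ₂(ξ)), where σ₁ = x_{11} + x_{22} and σ₂ = det_q. (ii') If ξ₁ − q^{-2}ξ₂, …, ξ₁ − q^{-2m}ξ₂ are non-zero and ξ₁ − q^{-2m-2}ξ₂ = 0, then the image of α^ξ is O(D\GL_q)^{≤m}, and the kernel of α^ξ is the sum of O(M_q)·(σ₁ − σ₁(ξ)) + O(M_q)·(σ₂ − σ₂(ξ)) and the O(GL_q)-subcomodule of (O(M_q), α) generated by the powers x_{21}^k with k > m. -/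

import Mathlib

open TensorProduct

noncomputable section

/-- Number of inversions (the length) of a permutation of `Fin t`. -/
def invCount {t : ℕ} (σ : Equiv.Perm (Fin t)) : ℕ :=
  (Finset.univ.filter fun p : Fin t × Fin t => p.1 < p.2 ∧ σ p.2 < σ p.1).card

/-- The principal quantum minor `[I|I]` of the matrix of generators `x`. -/
def qMinor {A : Type} [CommRing A] {M : Type} [Ring M] [Algebra A M] {N : ℕ}
    (q : A) (x : Fin N → Fin N → M) (I : Finset (Fin N)) : M :=
  ∑ σ : Equiv.Perm (Fin I.card),
    ((-q) ^ invCount σ) •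
      ((List.finRange I.card).map fun k =>
        x ((I.orderIsoOfFin rfl) k).1 ((I.orderIsoOfFin rfl) (σ k)).1).prod

/-- The quantum determinant. -/
def qdet {A : Type} [CommRing A] {M : Type} [Ring M] [Algebra A M] {N : ℕ}
    (q : A) (x : Fin N → Fin N → M) : M :=
  qMinor q x Finset.univ

/-- `w(I)`: the sum of the elements of `I` (with `{1, …, N}` indexing). -/
def wtSet {N : ℕ} (I : Finset (Fin N)) : ℕ := ∑ j ∈ I, (j.1 + 1)

/-- The weighted sum `τ_i` of principal quantum minors of size `i`. -/
def tauCoinv {A : Type} [CommRing A] {M : Type} [Ring M] [Algebra A M] {N : ℕ}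
    (q qinv : A) (x : Fin N → Fin N → M) (i : ℕ) : M :=
  ∑ I ∈ Finset.univ.filter (fun I : Finset (Fin N) => I.card = i),
    qinv ^ (2 * wtSet I) • qMinor q x I

/-- The sum `σ_i` of all principal quantum minors of size `i`. -/
def sigmaCoinv {A : Type} [CommRing A] {M : Type} [Ring M] [Algebra A M] {N : ℕ}
    (q : A) (x : Fin N → Fin N → M) (i : ℕ) : M :=
  ∑ I ∈ Finset.univ.filter (fun I : Finset (Fin N) => I.card = i), qMinor q x I

/-- The right adjoint coaction `β(h) = Σ h₂ ⊗ S(h₁)h₃`. -/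
def adjBeta {A : Type} [CommRing A] {M G : Type} [Ring M] [Algebra A M] [Ring G] [Algebra A G]
    (ΔM : M →ₐ[A] M ⊗[A] M) (ι : M →ₐ[A] G) (St : G →ₗ[A] G) : M →ₗ[A] M ⊗[A] G :=
  TensorProduct.map LinearMap.id (LinearMap.mul' A G) ∘ₗ
  (TensorProduct.assoc A M G G).toLinearMap ∘ₗ
  TensorProduct.map
    ((TensorProduct.comm A G M).toLinearMap ∘ₗ
      TensorProduct.map (St ∘ₗ ι.toLinearMap) LinearMap.id)
    ι.toLinearMap ∘ₗ
  TensorProduct.map ΔM.toLinearMap LinearMap.id ∘ₗ ΔM.toLinearMap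

/-- The right coaction `α(h) = Σ h₂ ⊗ h₃S(h₁)`. -/
def adjAlpha {A : Type} [CommRing A] {M G : Type} [Ring M] [Algebra A M] [Ring G] [Algebra A G]
    (ΔM : M →ₐ[A] M ⊗[A] M) (ι : M →ₐ[A] G) (St : G →ₗ[A] G) : M →ₗ[A] M ⊗[A] G :=
  TensorProduct.map LinearMap.id (LinearMap.mul' A G) ∘ₗ
  TensorProduct.map LinearMap.id (TensorProduct.comm A G G).toLinearMap ∘ₗ
  (TensorProduct.assoc A M G G).toLinearMap ∘ₗ
  TensorProduct.map
    ((TensorProduct.comm A G M).toLinearMap ∘ₗ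
      TensorProduct.map (St ∘ₗ ι.toLinearMap) LinearMap.id)
    ι.toLinearMap ∘ₗ
  TensorProduct.map ΔM.toLinearMap LinearMap.id ∘ₗ ΔM.toLinearMap

/-- The co-orbit map associated to a point `e = ev_ξ` and a coaction `b`. -/
def coorbit {A : Type} [CommRing A] {M G : Type} [Ring M] [Algebra A M] [Ring G] [Algebra A G]
    (e : M →ₐ[A] A) (b : M →ₗ[A] M ⊗[A] G) : M →ₗ[A] G :=
  (TensorProduct.lid A G).toLinearMap ∘ₗ TensorProduct.map e.toLinearMap LinearMap.id ∘ₗ b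

/-- The left coaction `λ_D = (π_D ⊗ id) ∘ Δ` of a quotient Hopf algebra. -/
def leftCoact {A : Type} [CommRing A] {G D : Type} [Ring G] [Algebra A G]
    [CommRing D] [Algebra A D]
    (πD : G →ₐ[A] D) (ΔG : G →ₐ[A] G ⊗[A] G) : G →ₗ[A] D ⊗[A] G :=
  TensorProduct.map πD.toLinearMap LinearMap.id ∘ₗ ΔG.toLinearMap

/-- Coinvariants of the left coaction `λ_D`. -/
def dCoinv {A : Type} [CommRing A] {G D : Type} [Ring G] [Algebra A G]
    [CommRing D] [Algebra A D]
    (πD : G →ₐ[A] D) (ΔG : G →ₐ[A] G ⊗[A] G) : Set G :=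
  {f : G | leftCoact πD ΔG f = (1 : D) ⊗ₜ[A] f}

/-- The right coaction `ρ_D = (id ⊗ π_D) ∘ Δ`. -/
def rightCoact {A : Type} [CommRing A] {G D : Type} [Ring G] [Algebra A G]
    [CommRing D] [Algebra A D]
    (πD : G →ₐ[A] D) (ΔG : G →ₐ[A] G ⊗[A] G) : G →ₗ[A] G ⊗[A] D :=
  TensorProduct.map LinearMap.id πD.toLinearMap ∘ₗ ΔG.toLinearMap

/-- The weight space of weight `ta : D` for the grading induced by `ρ_D`. -/
def weightSpace' {A : Type} [CommRing A] {G D : Type} [Ring G] [Algebra A G]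
    [CommRing D] [Algebra A D]
    (πD : G →ₐ[A] D) (ΔG : G →ₐ[A] G ⊗[A] G) (ta : D) : Submodule A G :=
  LinearMap.ker (rightCoact πD ΔG - (TensorProduct.mk A G D).flip ta)

/-- The subcomodule generated by a subset `s` of the comodule `(M, b)`. -/
def comodGen {A : Type} [CommRing A] {M G : Type} [Ring M] [Algebra A M] [Ring G] [Algebra A G]
    (b : M →ₗ[A] M ⊗[A] G) (s : Set M) : Submodule A M :=
  sInf {W : Submodule A M | s ⊆ W ∧
    ∀ w ∈ W, b w ∈ LinearMap.range (TensorProduct.map W.subtype (LinearMap.id : G →ₗ[A] G))}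

/-- The relations of the algebra of `2 × 2` quantum matrices. -/
structure IsQuantumMatrix {R : Type} [Ring R] [Algebra ℂ R] (q : ℂ) (x : Fin 2 → Fin 2 → R) :
    Prop where
  ab : x 0 0 * x 0 1 = q • (x 0 1 * x 0 0)
  ac : x 0 0 * x 1 0 = q • (x 1 0 * x 0 0)
  cb : x 1 0 * x 0 1 = x 0 1 * x 1 0
  db : x 1 1 * x 0 1 = q⁻¹ • (x 0 1 * x 1 1)
  dc : x 1 1 * x 1 0 = q⁻¹ • (x 1 0 * x 1 1)
  da : x 1 1 * x 0 0 = x 0 0 * x 1 1 - (q - q⁻¹) • (x 0 1 * x 1 0)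

/-- The quantum determinant of a `2 × 2` matrix. -/
def det₂ {R : Type} [Ring R] [Algebra ℂ R] (q : ℂ) (x : Fin 2 → Fin 2 → R) : R :=
  x 0 0 * x 1 1 - q • (x 0 1 * x 1 0)

namespace IsQuantumMatrix

variable {R : Type} [Ring R] [Algebra ℂ R] {q : ℂ} {x : Fin 2 → Fin 2 → R}

theorem ab' (h : IsQuantumMatrix q x) (z : R) :
    x 0 0 * (x 0 1 * z) = q • (x 0 1 * (x 0 0 * z)) := by
  rw [← mul_assoc, h.ab, smul_mul_assoc, mul_assoc]

theorem ac' (h : IsQuantumMatrix q x) (z : R) :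
    x 0 0 * (x 1 0 * z) = q • (x 1 0 * (x 0 0 * z)) := by
  rw [← mul_assoc, h.ac, smul_mul_assoc, mul_assoc]

theorem cb' (h : IsQuantumMatrix q x) (z : R) :
    x 1 0 * (x 0 1 * z) = x 0 1 * (x 1 0 * z) := by
  rw [← mul_assoc, h.cb, mul_assoc]

theorem db' (h : IsQuantumMatrix q x) (z : R) :
    x 1 1 * (x 0 1 * z) = q⁻¹ • (x 0 1 * (x 1 1 * z)) := by
  rw [← mul_assoc, h.db, smul_mul_assoc, mul_assoc]

theorem dc' (h : IsQuantumMatrix q x) (z : R) :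
    x 1 1 * (x 1 0 * z) = q⁻¹ • (x 1 0 * (x 1 1 * z)) := by
  rw [← mul_assoc, h.dc, smul_mul_assoc, mul_assoc]

theorem da' (h : IsQuantumMatrix q x) (z : R) :
    x 1 1 * (x 0 0 * z) = x 0 0 * (x 1 1 * z) - (q - q⁻¹) • (x 0 1 * (x 1 0 * z)) := by
  rw [← mul_assoc, h.da, sub_mul, smul_mul_assoc, mul_assoc, mul_assoc]

theorem det_comm (h : IsQuantumMatrix q x) (hq : q ≠ 0) (i j : Fin 2) :
    Commute (det₂ q x) (x i j) := by
  fin_cases i <;> fin_cases j <;>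
  · simp only [Commute, SemiconjBy, det₂, Fin.zero_eta, Fin.mk_one, sub_mul, mul_sub, mul_assoc,
      smul_mul_assoc, mul_smul_comm, h.ab, h.ac, h.cb, h.db, h.dc, h.da, h.ab', h.ac', h.cb',
      h.db', h.dc', h.da', smul_sub, smul_smul]
    match_scalars <;> field_simp <;> ring

/-- Exchanging an entry of the second row with an entry of the first row. -/
theorem swap (h : IsQuantumMatrix q x) (hq : q ≠ 0) (s k : Fin 2) :
    ∃ κ : ℂ, x 1 s * x 0 k = q⁻¹ • (x 0 s * x 1 k) + κ • det₂ q x := by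
  fin_cases s <;> fin_cases k
  · refine ⟨0, ?_⟩
    simp only [Fin.zero_eta, h.ac, smul_smul, inv_mul_cancel₀ hq, one_smul, zero_smul, add_zero]
  · refine ⟨-q⁻¹, ?_⟩
    simp only [Fin.zero_eta, Fin.mk_one, h.cb, det₂]
    match_scalars <;> field_simp <;> ring
  · refine ⟨1, ?_⟩
    simp only [Fin.zero_eta, Fin.mk_one, h.da, det₂]
    match_scalars <;> field_simp <;> ring
  · refine ⟨0, ?_⟩
    simp only [Fin.mk_one, h.db, zero_smul, add_zero]

end IsQuantumMatrix

/-- Quantum matrices together with a two-sided inverse of the quantum determinant. -/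
structure IsQuantumGL {R : Type} [Ring R] [Algebra ℂ R] (q : ℂ) (x : Fin 2 → Fin 2 → R) (δ : R) :
    Prop extends IsQuantumMatrix q x where
  ne : q ≠ 0
  det_mul : det₂ q x * δ = 1
  mul_det : δ * det₂ q x = 1

/-- The span of `1` and of the elements `x_{1j} x_{2k} / det`. -/
def torusInv {R : Type} [Ring R] [Algebra ℂ R] (x : Fin 2 → Fin 2 → R) (δ : R) : Submodule ℂ R :=
  Submodule.span ℂ ({1} ∪ Set.range fun p : Fin 2 × Fin 2 => x 0 p.1 * x 1 p.2 * δ)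

namespace IsQuantumGL

variable {R : Type} [Ring R] [Algebra ℂ R] {q : ℂ} {x : Fin 2 → Fin 2 → R} {δ : R}

theorem inv_comm (h : IsQuantumGL q x δ) (i j : Fin 2) : δ * x i j = x i j * δ := by
  calc δ * x i j = δ * x i j * (det₂ q x * δ) := by rw [h.det_mul, mul_one]
    _ = δ * (x i j * det₂ q x) * δ := by simp only [mul_assoc]
    _ = δ * (det₂ q x * x i j) * δ := by rw [(h.det_comm h.ne i j).eq]
    _ = (δ * det₂ q x) * x i j * δ := by simp only [mul_assoc]
    _ = x i j * δ := by rw [h.mul_det, one_mul]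

theorem inv_comm' (h : IsQuantumGL q x δ) (i j : Fin 2) (z : R) :
    δ * (x i j * z) = x i j * (δ * z) := by
  rw [← mul_assoc, h.inv_comm, mul_assoc]

theorem swap_inv (h : IsQuantumGL q x δ) (s k : Fin 2) :
    ∃ κ : ℂ, x 1 s * x 0 k * δ = q⁻¹ • (x 0 s * x 1 k * δ) + κ • 1 := by
  obtain ⟨κ, hκ⟩ := h.swap h.ne s k
  exact ⟨κ, by rw [hκ, add_mul, smul_mul_assoc, smul_mul_assoc, h.det_mul]⟩

theorem swap_inv' (h : IsQuantumGL q x δ) (s k : Fin 2) :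
    ∃ κ : ℂ, x 0 s * x 1 k * δ = q • (x 1 s * x 0 k * δ) + κ • 1 := by
  obtain ⟨κ, hκ⟩ := h.swap_inv s k
  refine ⟨-q * κ, ?_⟩
  rw [hκ, smul_add, smul_smul, mul_inv_cancel₀ h.ne]
  module

theorem one_mem_torusInv : (1 : R) ∈ torusInv x δ := Submodule.subset_span (Or.inl rfl)

theorem mem_torusInv (j k : Fin 2) : x 0 j * x 1 k * δ ∈ torusInv x δ :=
  Submodule.subset_span (Or.inr ⟨(j, k), rfl⟩)

theorem mem_torusInv' (h : IsQuantumGL q x δ) (j k : Fin 2) : x 1 j * x 0 k * δ ∈ torusInv x δ := by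
  obtain ⟨κ, hκ⟩ := h.swap_inv j k
  rw [hκ]
  exact add_mem (Submodule.smul_mem _ _ (mem_torusInv j k))
    (Submodule.smul_mem _ _ one_mem_torusInv)

theorem pow_le_succ (n : ℕ) : torusInv x δ ^ n ≤ torusInv x δ ^ (n + 1) := by
  intro f hf
  rw [pow_succ]
  simpa using Submodule.mul_mem_mul hf one_mem_torusInv

theorem pow_mono {m n : ℕ} (hmn : m ≤ n) : torusInv x δ ^ m ≤ torusInv x δ ^ n :=
  monotone_nat_of_le_succ (f := fun n => torusInv x δ ^ n) pow_le_succ hmn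

theorem mul_mem_pow {n : ℕ} {f g : R} (hf : f ∈ torusInv x δ ^ n) (hg : g ∈ torusInv x δ) :
    f * g ∈ torusInv x δ ^ (n + 1) := by
  rw [pow_succ]; exact Submodule.mul_mem_mul hf hg

/-- Induction on the filtration degree, peeling off the last factor. -/
theorem pow_induction {p : ℕ → R → Prop} (h1 : p 0 1)
    (hadd : ∀ n f g, p n f → p n g → p n (f + g)) (hsmul : ∀ n (c : ℂ) f, p n f → p n (c • f))
    (hsucc : ∀ n f, f ∈ torusInv x δ ^ n → p n f → p (n + 1) f)
    (hmul : ∀ n f, f ∈ torusInv x δ ^ n → p n f → ∀ r s, p (n + 1) (f * (x 0 r * x 1 s * δ))) :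
    ∀ n f, f ∈ torusInv x δ ^ n → p n f := by
  intro n
  induction n with
  | zero =>
    intro f hf
    rw [pow_zero] at hf
    obtain ⟨c, rfl⟩ := Submodule.mem_one.1 hf
    rw [Algebra.algebraMap_eq_smul_one]
    exact hsmul _ _ _ h1
  | succ n ih =>
    intro f hf
    rw [pow_succ] at hf
    induction hf using Submodule.mul_induction_on' with
    | add f _ g _ hf hg => exact hadd _ _ _ hf hg
    | mem_mul_mem g hg l hl =>
      induction hl using Submodule.span_induction with
      | zero => simpa using hsmul _ 0 _ (hsucc n g hg (ih g hg))
      | add a b _ _ ha hb => rw [mul_add]; exact hadd _ _ _ ha hb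
      | smul c a _ ha => rw [mul_smul_comm]; exact hsmul _ _ _ ha
      | mem a ha =>
        rcases ha with rfl | ⟨⟨r, s⟩, rfl⟩
        · rw [mul_one]; exact hsucc n g hg (ih g hg)
        · exact hmul n g hg (ih g hg) r s

theorem sandwich_mem (h : IsQuantumGL q x δ) : ∀ (n : ℕ) (f : R), f ∈ torusInv x δ ^ n →
    (∀ j k, x 0 j * f * x 1 k * δ ∈ torusInv x δ ^ (n + 1)) ∧
    ∀ j k, x 1 j * f * x 0 k * δ ∈ torusInv x δ ^ (n + 1) := by
  refine pow_induction ⟨fun j k => ?_, fun j k => ?_⟩ ?_ ?_ ?_ ?_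
  · simpa using mem_torusInv j k
  · simpa using h.mem_torusInv' j k
  · intro n f g hf hg
    simp only [mul_add, add_mul]
    exact ⟨fun j k => add_mem (hf.1 j k) (hg.1 j k), fun j k => add_mem (hf.2 j k) (hg.2 j k)⟩
  · intro n c f hf
    simp only [mul_smul_comm, smul_mul_assoc]
    exact ⟨fun j k => Submodule.smul_mem _ _ (hf.1 j k),
      fun j k => Submodule.smul_mem _ _ (hf.2 j k)⟩
  · intro n f _ hf
    exact ⟨fun j k => pow_le_succ _ (hf.1 j k), fun j k => pow_le_succ _ (hf.2 j k)⟩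
  · intro n f _ hf r s
    constructor
    · intro j k
      obtain ⟨κ, hκ⟩ := h.swap_inv' r s
      have : x 0 j * (f * (x 0 r * x 1 s * δ)) * x 1 k * δ
          = q • ((x 0 j * f * x 1 r * δ) * (x 0 s * x 1 k * δ)) + κ • (x 0 j * f * x 1 k * δ) := by
        rw [hκ]
        simp only [mul_add, add_mul, mul_assoc, mul_smul_comm, smul_mul_assoc, h.inv_comm,
          h.inv_comm', mul_one]
      rw [this]
      exact add_mem (Submodule.smul_mem _ _ (mul_mem_pow (hf.1 j r) (mem_torusInv s k)))
        (Submodule.smul_mem _ _ (pow_le_succ _ (hf.1 j k)))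
    · intro j k
      obtain ⟨κ, hκ⟩ := h.swap_inv s k
      have : x 1 j * (f * (x 0 r * x 1 s * δ)) * x 0 k * δ
          = q⁻¹ • ((x 1 j * f * x 0 r * δ) * (x 0 s * x 1 k * δ))
            + κ • (x 1 j * f * x 0 r * δ) := by
        calc _ = x 1 j * f * x 0 r * δ * (x 1 s * x 0 k * δ) := by
              simp only [mul_assoc, h.inv_comm, h.inv_comm']
          _ = _ := by rw [hκ, mul_add, mul_smul_comm, mul_smul_comm, mul_one]
      rw [this]
      exact add_mem (Submodule.smul_mem _ _ (mul_mem_pow (hf.2 j r) (mem_torusInv s k)))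
        (Submodule.smul_mem _ _ (pow_le_succ _ (hf.2 j r)))

/-- Up to terms of lower degree, the two ways of surrounding an element of degree `n` agree
up to a power of `q`. -/
theorem sandwich_sub_mem (h : IsQuantumGL q x δ) : ∀ (n : ℕ) (f : R), f ∈ torusInv x δ ^ n →
    ∀ j k, q ^ (2 * n + 1) • (x 1 j * f * x 0 k * δ) - x 0 j * f * x 1 k * δ
      ∈ torusInv x δ ^ n := by
  have hq := h.ne
  refine pow_induction ?_ ?_ ?_ ?_ ?_
  · intro j k
    obtain ⟨κ, hκ⟩ := h.swap_inv j k
    rw [mul_one, mul_one, hκ, pow_zero, Submodule.one_eq_span]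
    refine Submodule.mem_span_singleton.2 ⟨q * κ, ?_⟩
    match_scalars <;> field_simp <;> ring
  · intro n f g hf hg j k
    convert add_mem (hf j k) (hg j k) using 1
    simp only [mul_add, add_mul, smul_add]
    abel
  · intro n c f hf j k
    convert Submodule.smul_mem _ c (hf j k) using 1
    simp only [mul_smul_comm, smul_mul_assoc, smul_sub, smul_comm c]
  · intro n f hf _ j k
    have := h.sandwich_mem n f hf
    exact sub_mem (Submodule.smul_mem _ _ (this.2 j k)) (this.1 j k)
  · intro n f hf ih r s j k
    obtain ⟨κ, hκ⟩ := h.swap_inv s k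
    obtain ⟨μ, hμ⟩ := h.swap_inv r s
    have h1 : x 1 j * (f * (x 0 r * x 1 s * δ)) * x 0 k * δ
        = q⁻¹ • ((x 1 j * f * x 0 r * δ) * (x 0 s * x 1 k * δ))
          + κ • (x 1 j * f * x 0 r * δ) := by
      calc _ = x 1 j * f * x 0 r * δ * (x 1 s * x 0 k * δ) := by
            simp only [mul_assoc, h.inv_comm, h.inv_comm']
        _ = _ := by rw [hκ, mul_add, mul_smul_comm, mul_smul_comm, mul_one]
    have h2 : (x 0 j * f * x 1 r * δ) * (x 0 s * x 1 k * δ)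
        = q⁻¹ • (x 0 j * (f * (x 0 r * x 1 s * δ)) * x 1 k * δ)
          + μ • (x 0 j * f * x 1 k * δ) := by
      calc _ = x 0 j * f * (x 1 r * x 0 s * δ) * x 1 k * δ := by
            simp only [mul_assoc, h.inv_comm, h.inv_comm']
        _ = _ := by
            rw [hμ]
            simp only [mul_add, add_mul, mul_smul_comm, smul_mul_assoc, mul_one, mul_assoc]
    have key : q ^ (2 * (n + 1) + 1) • (x 1 j * (f * (x 0 r * x 1 s * δ)) * x 0 k * δ)
          - x 0 j * (f * (x 0 r * x 1 s * δ)) * x 1 k * δ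
        = q • ((q ^ (2 * n + 1) • (x 1 j * f * x 0 r * δ) - x 0 j * f * x 1 r * δ)
            * (x 0 s * x 1 k * δ))
          + (q * μ) • (x 0 j * f * x 1 k * δ)
          + (q ^ (2 * (n + 1) + 1) * κ) • (x 1 j * f * x 0 r * δ) := by
      rw [h1, sub_mul, h2, smul_mul_assoc]
      match_scalars <;> field_simp <;> ring
    rw [key]
    have := h.sandwich_mem n f hf
    exact add_mem (add_mem (Submodule.smul_mem _ _ (mul_mem_pow (ih j r) (mem_torusInv s k)))
      (Submodule.smul_mem _ _ (this.1 j k))) (Submodule.smul_mem _ _ (this.2 j r))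

/-- The next step of the filtration is obtained by surrounding elements of the previous one. -/
theorem pow_succ_le (h : IsQuantumGL q x δ) (n : ℕ) (W : Submodule ℂ R)
    (hW : torusInv x δ ^ n ≤ W)
    (hW' : ∀ f ∈ torusInv x δ ^ n, ∀ j k, x 0 j * f * x 1 k * δ ∈ W) :
    torusInv x δ ^ (n + 1) ≤ W := by
  have key : ∀ n : ℕ, torusInv x δ ^ (n + 1) ≤ torusInv x δ ^ n ⊔
      Submodule.span ℂ {y | ∃ f ∈ torusInv x δ ^ n, ∃ j k, y = x 0 j * f * x 1 k * δ} := by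
    intro n
    induction n with
    | zero =>
      rw [zero_add, pow_one, torusInv, Submodule.span_le]
      rintro _ (rfl | ⟨⟨j, k⟩, rfl⟩)
      · exact Submodule.mem_sup_left (by rw [pow_zero]; exact Submodule.one_le.1 le_rfl)
      · exact Submodule.mem_sup_right (Submodule.subset_span ⟨1, by
          rw [pow_zero]; exact Submodule.one_le.1 le_rfl, j, k, by simp⟩)
    | succ n ih =>
      rw [pow_succ _ (n + 1), Submodule.mul_le]
      intro g hg l hl
      obtain ⟨g₁, hg₁, g₂, hg₂, rfl⟩ := Submodule.mem_sup.1 (ih hg)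
      rw [add_mul]
      refine add_mem (Submodule.mem_sup_left (mul_mem_pow hg₁ hl)) ?_
      clear hg
      induction hg₂ using Submodule.span_induction with
      | zero => rw [zero_mul]; exact zero_mem _
      | add a b _ _ ha hb => rw [add_mul]; exact add_mem ha hb
      | smul c a _ ha => rw [smul_mul_assoc]; exact Submodule.smul_mem _ _ ha
      | mem a ha =>
        obtain ⟨f, hf, j, k, rfl⟩ := ha
        induction hl using Submodule.span_induction with
        | zero => rw [mul_zero]; exact zero_mem _
        | add a b _ _ ha hb => rw [mul_add]; exact add_mem ha hb
        | smul c a _ ha => rw [mul_smul_comm]; exact Submodule.smul_mem _ _ ha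
        | mem a ha =>
          rcases ha with rfl | ⟨⟨r, s⟩, rfl⟩
          · rw [mul_one]
            exact Submodule.mem_sup_left ((h.sandwich_mem n f hf).1 j k)
          · refine Submodule.mem_sup_right (Submodule.subset_span
              ⟨f * (x 1 k * x 0 r * δ), mul_mem_pow hf (h.mem_torusInv' k r), j, s, ?_⟩)
            simp only [mul_assoc, h.inv_comm, h.inv_comm']
  refine (key n).trans (sup_le hW (Submodule.span_le.2 ?_))
  rintro _ ⟨f, hf, j, k, rfl⟩
  exact hW' f hf j k

/-- The operator `f ↦ ξ₁ x_{1j} f x_{2k} det⁻¹ - q⁻¹ ξ₂ x_{2j} f x_{1k} det⁻¹`. -/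
def conj (q ξ₁ ξ₂ : ℂ) (x : Fin 2 → Fin 2 → R) (δ : R) (j k : Fin 2) (f : R) : R :=
  ξ₁ • (x 0 j * f * x 1 k * δ) - (q⁻¹ * ξ₂) • (x 1 j * f * x 0 k * δ)

theorem conj_sub_mem (h : IsQuantumGL q x δ) (ξ₁ ξ₂ : ℂ) {n : ℕ} {f : R}
    (hf : f ∈ torusInv x δ ^ n) (j k : Fin 2) :
    conj q ξ₁ ξ₂ x δ j k f - (ξ₁ - (q ^ (2 * (n + 1)))⁻¹ * ξ₂) • (x 0 j * f * x 1 k * δ)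
      ∈ torusInv x δ ^ n := by
  have hq := h.ne
  convert Submodule.smul_mem _ (-(q ^ (2 * (n + 1)))⁻¹ * ξ₂) (h.sandwich_sub_mem n f hf j k) using 1
  rw [conj]
  match_scalars <;> field_simp <;> ring

theorem conj_mem (h : IsQuantumGL q x δ) (ξ₁ ξ₂ : ℂ) {n : ℕ} {f : R}
    (hf : f ∈ torusInv x δ ^ n) (j k : Fin 2) :
    conj q ξ₁ ξ₂ x δ j k f ∈ torusInv x δ ^ (n + 1) :=
  sub_mem (Submodule.smul_mem _ _ ((h.sandwich_mem n f hf).1 j k))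
    (Submodule.smul_mem _ _ ((h.sandwich_mem n f hf).2 j k))

end IsQuantumGL

/-- The span of `1` and of the entries of `x`. -/
def entries {R : Type} [Ring R] [Algebra ℂ R] (x : Fin 2 → Fin 2 → R) : Submodule ℂ R :=
  Submodule.span ℂ ({1} ∪ Set.range fun p : Fin 2 × Fin 2 => x p.1 p.2)

namespace entries

variable {R : Type} [Ring R] [Algebra ℂ R] {x : Fin 2 → Fin 2 → R}

theorem one_mem : (1 : R) ∈ entries x := Submodule.subset_span (Or.inl rfl)

theorem mem (i j : Fin 2) : x i j ∈ entries x := Submodule.subset_span (Or.inr ⟨(i, j), rfl⟩)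

theorem mul_mem {n : ℕ} {f : R} (i j : Fin 2) (hf : f ∈ entries x ^ n) :
    x i j * f ∈ entries x ^ (n + 1) := by
  rw [pow_succ']; exact Submodule.mul_mem_mul (mem i j) hf

theorem le_succ (n : ℕ) : entries x ^ n ≤ entries x ^ (n + 1) := by
  intro f hf
  rw [pow_succ']
  simpa using Submodule.mul_mem_mul one_mem hf

theorem mono {m n : ℕ} (hmn : m ≤ n) : entries x ^ m ≤ entries x ^ n :=
  monotone_nat_of_le_succ (f := fun n => entries x ^ n) le_succ hmn

/-- To contain all elements of degree at most `n + 1` it is enough to contain those of degree at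
most `n` and their left multiples by the entries. -/
theorem succ_le {n : ℕ} {W : Submodule ℂ R} (hW : entries x ^ n ≤ W)
    (hW' : ∀ f ∈ entries x ^ n, ∀ i j, x i j * f ∈ W) : entries x ^ (n + 1) ≤ W := by
  rw [pow_succ', Submodule.mul_le]
  intro l hl f hf
  induction hl using Submodule.span_induction with
  | zero => rw [zero_mul]; exact zero_mem _
  | add a b _ _ ha hb => rw [add_mul]; exact add_mem ha hb
  | smul c a _ ha => rw [smul_mul_assoc]; exact Submodule.smul_mem _ _ ha
  | mem a ha =>
    rcases ha with rfl | ⟨⟨i, j⟩, rfl⟩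
    · rw [one_mul]; exact hW hf
    · exact hW' f hf i j

theorem exists_mem (hgen : Algebra.adjoin ℂ (Set.range fun p : Fin 2 × Fin 2 => x p.1 p.2) = ⊤)
    (f : R) : ∃ n, f ∈ entries x ^ n := by
  have hf : f ∈ Algebra.adjoin ℂ (Set.range fun p : Fin 2 × Fin 2 => x p.1 p.2) := by
    rw [hgen]; trivial
  induction hf using Algebra.adjoin_induction with
  | mem y hy =>
    obtain ⟨⟨i, j⟩, rfl⟩ := hy
    exact ⟨1, by rw [pow_one]; exact mem i j⟩
  | algebraMap c =>
    exact ⟨0, by rw [pow_zero]; exact Submodule.algebraMap_mem c⟩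
  | add a b _ _ ha hb =>
    obtain ⟨m, hm⟩ := ha
    obtain ⟨n, hn⟩ := hb
    exact ⟨max m n, add_mem (mono (le_max_left _ _) hm) (mono (le_max_right _ _) hn)⟩
  | mul a b _ _ ha hb =>
    obtain ⟨m, hm⟩ := ha
    obtain ⟨n, hn⟩ := hb
    exact ⟨m + n, by rw [pow_add]; exact Submodule.mul_mem_mul hm hn⟩

/-- Induction on generators, multiplying from the left. -/
theorem induction_left
    (hgen : Algebra.adjoin ℂ (Set.range fun p : Fin 2 × Fin 2 => x p.1 p.2) = ⊤)
    (W : Submodule ℂ R) (h1 : 1 ∈ W) (hmul : ∀ i j, ∀ f ∈ W, x i j * f ∈ W) (f : R) : f ∈ W := by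
  obtain ⟨n, hn⟩ := exists_mem hgen f
  have key : ∀ n, entries x ^ n ≤ W := by
    intro n
    induction n with
    | zero => rw [pow_zero]; exact Submodule.one_le.2 h1
    | succ n ih => exact succ_le ih fun f hf i j => hmul i j f (ih hf)
  exact key n hn

end entries

section Image

variable {M G : Type} [Ring M] [Algebra ℂ M] [Ring G] [Algebra ℂ G] {q : ℂ}
  {x : Fin 2 → Fin 2 → M} {y : Fin 2 → Fin 2 → G} {δ : G} {ξ₁ ξ₂ : ℂ} {s : Fin 2 → ℂ}
  {φ : M →ₗ[ℂ] G}

open IsQuantumGL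

theorem map_entries_pow_le (h : IsQuantumGL q y δ) (h1 : φ 1 = 1)
    (hφ : ∀ i j f, φ (x i j * f) = s i • conj q ξ₁ ξ₂ y δ j (1 - i) (φ f)) (n : ℕ) :
    (entries x ^ n).map φ ≤ torusInv y δ ^ n := by
  rw [Submodule.map_le_iff_le_comap]
  induction n with
  | zero =>
    rw [pow_zero, pow_zero, Submodule.one_le, Submodule.mem_comap, h1]
    exact Submodule.one_le.1 le_rfl
  | succ n ih =>
    refine entries.succ_le (fun f hf => pow_le_succ n (ih hf)) fun f hf i j => ?_
    rw [Submodule.mem_comap, hφ]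
    exact Submodule.smul_mem _ _ (h.conj_mem ξ₁ ξ₂ (ih hf) j (1 - i))

theorem map_entries_pow (h : IsQuantumGL q y δ) (h1 : φ 1 = 1)
    (hφ : ∀ i j f, φ (x i j * f) = s i • conj q ξ₁ ξ₂ y δ j (1 - i) (φ f)) (hs : ∀ i, s i ≠ 0)
    (n : ℕ) (hξ : ∀ k, 1 ≤ k → k ≤ n → ξ₁ - (q ^ (2 * k))⁻¹ * ξ₂ ≠ 0) :
    (entries x ^ n).map φ = torusInv y δ ^ n := by
  refine le_antisymm (map_entries_pow_le h h1 hφ n) ?_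
  induction n with
  | zero =>
    rw [pow_zero, pow_zero, Submodule.one_le]
    exact ⟨1, Submodule.one_le.1 le_rfl, h1⟩
  | succ n ih =>
    have ih := ih fun k hk hkn => hξ k hk (hkn.trans n.le_succ)
    have hle : torusInv y δ ^ n ≤ (entries x ^ (n + 1)).map φ :=
      ih.trans (Submodule.map_mono (entries.le_succ n))
    refine h.pow_succ_le n _ hle fun f hf j k => ?_
    obtain ⟨g, hg, rfl⟩ := ih hf
    have hc : conj q ξ₁ ξ₂ y δ j k (φ g) ∈ (entries x ^ (n + 1)).map φ := by
      have : φ (x (1 - k) j * g) = s (1 - k) • conj q ξ₁ ξ₂ y δ j k (φ g) := by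
        rw [hφ, sub_sub_cancel]
      rw [← Submodule.smul_mem_iff _ (hs (1 - k)), ← this]
      exact ⟨_, entries.mul_mem _ _ hg, rfl⟩
    have := sub_mem hc (hle (h.conj_sub_mem ξ₁ ξ₂ hf j k))
    rwa [sub_sub_cancel, Submodule.smul_mem_iff _ (hξ (n + 1) (by lia) le_rfl)] at this

theorem map_entries_pow_le_of_eq_zero (h : IsQuantumGL q y δ) (h1 : φ 1 = 1)
    (hφ : ∀ i j f, φ (x i j * f) = s i • conj q ξ₁ ξ₂ y δ j (1 - i) (φ f))
    {m : ℕ} (hξ : ξ₁ - (q ^ (2 * m + 2))⁻¹ * ξ₂ = 0) (n : ℕ) :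
    (entries x ^ n).map φ ≤ torusInv y δ ^ m := by
  rw [Submodule.map_le_iff_le_comap]
  induction n with
  | zero =>
    rw [pow_zero, Submodule.one_le, Submodule.mem_comap, h1]
    exact pow_mono (Nat.zero_le m) (by rw [pow_zero]; exact Submodule.one_le.1 le_rfl)
  | succ n ih =>
    refine entries.succ_le ih fun f hf i j => ?_
    rw [Submodule.mem_comap, hφ]
    have := h.conj_sub_mem ξ₁ ξ₂ (ih hf) j (1 - i)
    rw [mul_add, mul_one, hξ, zero_smul, sub_zero] at this
    exact Submodule.smul_mem _ _ this

end Image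

/-- The coordinate matrix bialgebra `M` and the Hopf algebra `G` of the quantum group `GL_q(2)`. -/
structure IsQuantumGroup {M G : Type} [Ring M] [Algebra ℂ M] [Ring G] [Algebra ℂ G] (q : ℂ)
    (x : Fin 2 → Fin 2 → M) (y : Fin 2 → Fin 2 → G) (δ : G) (ι : M →ₐ[ℂ] G)
    (ΔM : M →ₐ[ℂ] M ⊗[ℂ] M) (ΔG : G →ₐ[ℂ] G ⊗[ℂ] G) (εG : G →ₐ[ℂ] ℂ) (St : G →ₗ[ℂ] G) :
    Prop where
  mat : IsQuantumMatrix q x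
  gl : IsQuantumGL q y δ
  map : ∀ i j, ι (x i j) = y i j
  gen : Algebra.adjoin ℂ (Set.range fun p : Fin 2 × Fin 2 => x p.1 p.2) = ⊤
  genG : Algebra.adjoin ℂ (Set.range (fun p : Fin 2 × Fin 2 => y p.1 p.2) ∪ {δ}) = ⊤
  comulM : ∀ i j, ΔM (x i j) = ∑ k, x i k ⊗ₜ[ℂ] x k j
  comul_map : ∀ m, ΔG (ι m) = Algebra.TensorProduct.map ι ι (ΔM m)
  counit : ∀ i j, εG (y i j) = if i = j then 1 else 0
  antipode_mul_id : LinearMap.mul' ℂ G ∘ₗ TensorProduct.map St LinearMap.id ∘ₗ ΔG.toLinearMap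
    = Algebra.linearMap ℂ G ∘ₗ εG.toLinearMap
  id_mul_antipode : LinearMap.mul' ℂ G ∘ₗ TensorProduct.map LinearMap.id St ∘ₗ ΔG.toLinearMap
    = Algebra.linearMap ℂ G ∘ₗ εG.toLinearMap
  lift : ∀ (B : Type) [Ring B] [Algebra ℂ B] (z : Fin 2 → Fin 2 → B), IsQuantumMatrix q z →
    det₂ q z = 1 → ∃ ψ : G →ₐ[ℂ] B, ∀ i j, ψ (y i j) = z i j

/-- The quantum determinant is group-like. -/
theorem IsQuantumMatrix.sum_tmul_det {R S : Type} [Ring R] [Algebra ℂ R] [Ring S] [Algebra ℂ S]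
    {q : ℂ} {x : Fin 2 → Fin 2 → R} {y : Fin 2 → Fin 2 → S} (h : IsQuantumMatrix q x)
    (h' : IsQuantumMatrix q y) (hq : q ≠ 0) :
    det₂ q (fun i j => ∑ k, x i k ⊗ₜ[ℂ] y k j) = det₂ q x ⊗ₜ det₂ q y := by
  simp only [det₂, Fin.sum_univ_two, mul_add, add_mul, Algebra.TensorProduct.tmul_mul_tmul,
    h.ac, h'.ab, h'.dc, h'.cb, h'.da, TensorProduct.sub_tmul,
    TensorProduct.tmul_sub, TensorProduct.tmul_smul, ← TensorProduct.smul_tmul', smul_smul,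
    smul_add, smul_sub]
  match_scalars <;> field_simp <;> ring

namespace IsQuantumGroup

variable {M G : Type} [Ring M] [Algebra ℂ M] [Ring G] [Algebra ℂ G] {q : ℂ}
  {x : Fin 2 → Fin 2 → M} {y : Fin 2 → Fin 2 → G} {δ : G} {ι : M →ₐ[ℂ] G}
  {ΔM : M →ₐ[ℂ] M ⊗[ℂ] M} {ΔG : G →ₐ[ℂ] G ⊗[ℂ] G} {εG : G →ₐ[ℂ] ℂ} {St : G →ₗ[ℂ] G}

theorem algHom_ext (H : IsQuantumGroup q x y δ ι ΔM ΔG εG St) {B : Type} [Ring B] [Algebra ℂ B]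
    {f g : G →ₐ[ℂ] B} (hfg : ∀ i j, f (y i j) = g (y i j)) : f = g := by
  have hdet : f (det₂ q y) = g (det₂ q y) := by
    simp only [det₂, map_sub, map_mul, map_smul, hfg]
  refine AlgHom.ext_of_adjoin_eq_top H.genG ?_
  rintro _ (⟨⟨i, j⟩, rfl⟩ | h)
  · exact hfg i j
  · rw [Set.mem_singleton_iff.1 h]
    calc f δ = f δ * g (det₂ q y * δ) := by rw [H.gl.det_mul, map_one, mul_one]
      _ = f (δ * det₂ q y) * g δ := by rw [map_mul, map_mul, hdet, mul_assoc]
      _ = g δ := by rw [H.gl.mul_det, map_one, one_mul]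

theorem comul (H : IsQuantumGroup q x y δ ι ΔM ΔG εG St) (i j : Fin 2) :
    ΔG (y i j) = ∑ k, y i k ⊗ₜ[ℂ] y k j := by
  rw [← H.map, H.comul_map, H.comulM, map_sum]
  simp only [Algebra.TensorProduct.map_tmul, H.map]

theorem comulM_det (H : IsQuantumGroup q x y δ ι ΔM ΔG εG St) :
    ΔM (det₂ q x) = det₂ q x ⊗ₜ det₂ q x := by
  rw [← H.mat.sum_tmul_det H.mat H.gl.ne]
  simp only [det₂, map_sub, map_mul, map_smul, H.comulM]

theorem map_det (H : IsQuantumGroup q x y δ ι ΔM ΔG εG St) : ι (det₂ q x) = det₂ q y := by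
  simp only [det₂, map_sub, map_mul, map_smul, H.map]

theorem comul_det (H : IsQuantumGroup q x y δ ι ΔM ΔG εG St) :
    ΔG (det₂ q y) = det₂ q y ⊗ₜ det₂ q y := by
  rw [← H.map_det, H.comul_map, H.comulM_det, Algebra.TensorProduct.map_tmul]

theorem comul_inv (H : IsQuantumGroup q x y δ ι ΔM ΔG εG St) : ΔG δ = δ ⊗ₜ δ := by
  calc ΔG δ = ΔG δ * ((det₂ q y ⊗ₜ det₂ q y) * (δ ⊗ₜ δ)) := by
        rw [Algebra.TensorProduct.tmul_mul_tmul, H.gl.det_mul, ← Algebra.TensorProduct.one_def,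
          mul_one]
    _ = ΔG (δ * det₂ q y) * (δ ⊗ₜ δ) := by rw [map_mul, H.comul_det, mul_assoc]
    _ = δ ⊗ₜ δ := by rw [H.gl.mul_det, map_one, one_mul]

theorem coassoc (H : IsQuantumGroup q x y δ ι ΔM ΔG εG St) :
    (Algebra.TensorProduct.assoc ℂ ℂ ℂ G G G).toAlgHom.comp
      ((Algebra.TensorProduct.map ΔG (.id ℂ G)).comp ΔG)
      = (Algebra.TensorProduct.map (.id ℂ G) ΔG).comp ΔG := by
  refine H.algHom_ext fun i j => ?_
  simp only [AlgHom.comp_apply, H.comul, map_sum, Algebra.TensorProduct.map_tmul,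
    TensorProduct.sum_tmul, TensorProduct.tmul_sum, AlgHom.coe_id, id_eq]
  exact Finset.sum_comm

theorem counit_left (H : IsQuantumGroup q x y δ ι ΔM ΔG εG St) :
    (Algebra.TensorProduct.map εG (.id ℂ G)).comp ΔG
      = ((Algebra.TensorProduct.lid ℂ G).symm : G →ₐ[ℂ] ℂ ⊗[ℂ] G) := by
  refine H.algHom_ext fun i j => ?_
  fin_cases i <;> simp [H.comul, H.counit]

theorem counit_right (H : IsQuantumGroup q x y δ ι ΔM ΔG εG St) :
    (Algebra.TensorProduct.map (.id ℂ G) εG).comp ΔG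
      = ((Algebra.TensorProduct.rid ℂ ℂ G).symm : G →ₐ[ℂ] G ⊗[ℂ] ℂ) := by
  refine H.algHom_ext fun i j => ?_
  fin_cases j <;> simp [H.comul, H.counit]

/-- The Hopf algebra structure on the coordinate algebra of the quantum group. -/
abbrev hopfAlgebra (H : IsQuantumGroup q x y δ ι ΔM ΔG εG St) : HopfAlgebra ℂ G :=
  letI := Bialgebra.ofAlgHom ΔG εG H.coassoc H.counit_left H.counit_right
  { antipode := St
    mul_antipode_rTensor_comul := H.antipode_mul_id
    mul_antipode_lTensor_comul := H.id_mul_antipode }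

theorem antipode_mul (H : IsQuantumGroup q x y δ ι ΔM ΔG εG St) (f g : G) :
    St (f * g) = St g * St f :=
  letI := H.hopfAlgebra
  HopfAlgebra.antipode_mul_antidistrib f g

theorem antipode_one (H : IsQuantumGroup q x y δ ι ΔM ΔG εG St) : St 1 = 1 :=
  letI := H.hopfAlgebra
  HopfAlgebra.antipode_one

theorem sum_mul_antipode (H : IsQuantumGroup q x y δ ι ΔM ΔG εG St) (i j : Fin 2) :
    ∑ k, y i k * St (y k j) = if i = j then 1 else 0 := by
  have := congr($(H.id_mul_antipode) (y i j))
  simp only [LinearMap.comp_apply, AlgHom.toLinearMap_apply, H.comul, map_sum,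
    TensorProduct.map_tmul, LinearMap.id_apply, LinearMap.mul'_apply, H.counit] at this
  rw [this]
  split_ifs <;> simp

theorem antipode_det (H : IsQuantumGroup q x y δ ι ΔM ΔG εG St) : St (det₂ q y) = δ := by
  have h1 : εG (det₂ q y) = 1 := by simp [det₂, H.counit]
  have := congr($(H.id_mul_antipode) (det₂ q y))
  simp only [LinearMap.comp_apply, AlgHom.toLinearMap_apply, H.comul_det,
    TensorProduct.map_tmul, LinearMap.id_apply, LinearMap.mul'_apply, h1,
    Algebra.linearMap_apply, map_one] at this
  rw [← one_mul (St _), ← H.gl.mul_det, mul_assoc, this, mul_one]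

/-- Left multiplication by the adjugate matrix cancels the matrix of generators. -/
theorem eq_of_mul_col (H : IsQuantumGroup q x y δ ι ΔM ΔG εG St) {u v r s : G}
    (h0 : y 0 0 * u + y 0 1 * v = r) (h1 : y 1 0 * u + y 1 1 * v = s) :
    u = δ * (y 1 1 * r - q⁻¹ • (y 0 1 * s)) ∧ v = δ * (y 0 0 * s - q • (y 1 0 * r)) := by
  have hq := H.gl.ne
  have key : ∀ z, δ * (det₂ q y * z) = z := fun z => by rw [← mul_assoc, H.gl.mul_det, one_mul]
  subst h0 h1
  constructor
  · refine (key u).symm.trans ?_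
    congr 1
    simp only [det₂, sub_mul, mul_add, smul_mul_assoc, mul_assoc, H.gl.db', H.gl.da']
    match_scalars <;> field_simp <;> ring
  · refine (key v).symm.trans ?_
    congr 1
    simp only [det₂, sub_mul, mul_add, smul_mul_assoc, mul_assoc, H.gl.ac', H.gl.cb']
    match_scalars <;> field_simp <;> ring

theorem antipode_entries (H : IsQuantumGroup q x y δ ι ΔM ΔG εG St) :
    St (y 0 0) = y 1 1 * δ ∧ St (y 0 1) = -q⁻¹ • (y 0 1 * δ) ∧
      St (y 1 0) = -q • (y 1 0 * δ) ∧ St (y 1 1) = y 0 0 * δ := by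
  have h00 := H.sum_mul_antipode 0 0
  have h01 := H.sum_mul_antipode 0 1
  have h10 := H.sum_mul_antipode 1 0
  have h11 := H.sum_mul_antipode 1 1
  rw [Fin.sum_univ_two] at h00 h01 h10 h11
  obtain ⟨h1, h2⟩ := H.eq_of_mul_col h00 h10
  obtain ⟨h3, h4⟩ := H.eq_of_mul_col h01 h11
  simp only [mul_zero, mul_one, smul_zero, sub_zero, zero_sub, if_true, one_ne_zero, zero_ne_one,
    if_false, mul_neg, mul_smul_comm, H.gl.inv_comm] at h1 h2 h3 h4
  exact ⟨h1, by rw [h3, neg_smul], by rw [h2, neg_smul], h4⟩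

end IsQuantumGroup

/-- The linear map `(h₁ ⊗ h₂) ⊗ h₃ ↦ h₂ ⊗ h₃ S(h₁)`. -/
def alphaAux {M G : Type} [Ring M] [Algebra ℂ M] [Ring G] [Algebra ℂ G] (ι : M →ₐ[ℂ] G)
    (St : G →ₗ[ℂ] G) : (M ⊗[ℂ] M) ⊗[ℂ] M →ₗ[ℂ] M ⊗[ℂ] G :=
  TensorProduct.map LinearMap.id (LinearMap.mul' ℂ G) ∘ₗ
  TensorProduct.map LinearMap.id (TensorProduct.comm ℂ G G).toLinearMap ∘ₗ
  (TensorProduct.assoc ℂ M G G).toLinearMap ∘ₗ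
  TensorProduct.map
    ((TensorProduct.comm ℂ G M).toLinearMap ∘ₗ
      TensorProduct.map (St ∘ₗ ι.toLinearMap) LinearMap.id)
    ι.toLinearMap

theorem alphaAux_tmul {M G : Type} [Ring M] [Algebra ℂ M] [Ring G] [Algebra ℂ G] (ι : M →ₐ[ℂ] G)
    (St : G →ₗ[ℂ] G) (f g h : M) :
    alphaAux ι St ((f ⊗ₜ g) ⊗ₜ h) = g ⊗ₜ (ι h * St (ι f)) := by
  simp [alphaAux]

namespace IsQuantumGroup

variable {M G : Type} [Ring M] [Algebra ℂ M] [Ring G] [Algebra ℂ G] {q : ℂ}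
  {x : Fin 2 → Fin 2 → M} {y : Fin 2 → Fin 2 → G} {δ : G} {ι : M →ₐ[ℂ] G}
  {ΔM : M →ₐ[ℂ] M ⊗[ℂ] M} {ΔG : G →ₐ[ℂ] G ⊗[ℂ] G} {εG : G →ₐ[ℂ] ℂ} {St : G →ₗ[ℂ] G}

theorem alphaAux_mul (H : IsQuantumGroup q x y δ ι ΔM ΔG εG St) (f g h : M)
    (w : (M ⊗[ℂ] M) ⊗[ℂ] M) :
    alphaAux ι St (((f ⊗ₜ g) ⊗ₜ h) * w)
      = (g ⊗ₜ ι h) * alphaAux ι St w * (1 ⊗ₜ St (ι f)) := by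
  induction w with
  | zero => simp
  | add a b ha hb => rw [mul_add, map_add, ha, hb, map_add, mul_add, add_mul]
  | tmul w h' =>
    induction w with
    | zero => simp
    | add a b ha hb =>
      rw [TensorProduct.add_tmul, mul_add, map_add, ha, hb, map_add, mul_add, add_mul]
    | tmul f' g' =>
      simp only [Algebra.TensorProduct.tmul_mul_tmul, alphaAux_tmul, map_mul, H.antipode_mul,
        mul_one, mul_assoc]

theorem adjAlpha_one (H : IsQuantumGroup q x y δ ι ΔM ΔG εG St) :
    adjAlpha ΔM ι St 1 = 1 ⊗ₜ 1 := by
  change alphaAux ι St (Algebra.TensorProduct.map ΔM (AlgHom.id ℂ M) (ΔM 1)) = _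
  rw [map_one, map_one, Algebra.TensorProduct.one_def, Algebra.TensorProduct.one_def,
    alphaAux_tmul, map_one, H.antipode_one, mul_one]

theorem adjAlpha_mul (H : IsQuantumGroup q x y δ ι ΔM ΔG εG St) (i j : Fin 2) (f : M) :
    adjAlpha ΔM ι St (x i j * f)
      = ∑ k, ∑ l, (x k l ⊗ₜ y l j) * adjAlpha ΔM ι St f * (1 ⊗ₜ St (y i k)) := by
  change alphaAux ι St (Algebra.TensorProduct.map ΔM (AlgHom.id ℂ M) (ΔM (x i j * f)))
    = ∑ k, ∑ l, (x k l ⊗ₜ y l j) *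
      alphaAux ι St (Algebra.TensorProduct.map ΔM (AlgHom.id ℂ M) (ΔM f)) * (1 ⊗ₜ St (y i k))
  rw [map_mul, map_mul]
  simp only [H.comulM, map_sum, Algebra.TensorProduct.map_tmul, AlgHom.id_apply,
    TensorProduct.sum_tmul, Finset.sum_mul, H.alphaAux_mul, H.map]
  exact Finset.sum_comm

theorem adjAlpha_det (H : IsQuantumGroup q x y δ ι ΔM ΔG εG St) :
    adjAlpha ΔM ι St (det₂ q x) = det₂ q x ⊗ₜ 1 := by
  change alphaAux ι St (Algebra.TensorProduct.map ΔM (AlgHom.id ℂ M) (ΔM (det₂ q x))) = _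
  rw [H.comulM_det, Algebra.TensorProduct.map_tmul, H.comulM_det, AlgHom.id_apply, alphaAux_tmul,
    H.map_det, H.antipode_det, H.gl.det_mul]

theorem adjAlpha_trace (H : IsQuantumGroup q x y δ ι ΔM ΔG εG St) :
    adjAlpha ΔM ι St (x 0 0 + x 1 1) = (x 0 0 + x 1 1) ⊗ₜ 1 := by
  have h00 := H.sum_mul_antipode 0 0
  have h01 := H.sum_mul_antipode 0 1
  have h10 := H.sum_mul_antipode 1 0
  have h11 := H.sum_mul_antipode 1 1
  have key : ∀ i j, adjAlpha ΔM ι St (x i j)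
      = ∑ k, ∑ l, x k l ⊗ₜ (y l j * St (y i k)) := fun i j => by
    rw [← mul_one (x i j), H.adjAlpha_mul]
    simp only [H.adjAlpha_one, Algebra.TensorProduct.tmul_mul_tmul, mul_one]
  rw [Fin.sum_univ_two] at h00 h01 h10 h11
  simp only [map_add, key, Fin.sum_univ_two]
  calc _ = x 0 0 ⊗ₜ (y 0 0 * St (y 0 0) + y 0 1 * St (y 1 0))
        + x 0 1 ⊗ₜ (y 1 0 * St (y 0 0) + y 1 1 * St (y 1 0))
        + x 1 0 ⊗ₜ (y 0 0 * St (y 0 1) + y 0 1 * St (y 1 1))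
        + x 1 1 ⊗ₜ (y 1 0 * St (y 0 1) + y 1 1 * St (y 1 1)) := by
        simp only [TensorProduct.tmul_add]; abel
    _ = _ := by simp [h00, h01, h10, h11, TensorProduct.add_tmul]

/-- The coaction is linear over right multiplication by coinvariants. -/
theorem adjAlpha_mul_coinvariant (H : IsQuantumGroup q x y δ ι ΔM ΔG εG St) {z : M}
    (hz : adjAlpha ΔM ι St z = z ⊗ₜ 1) (f : M) :
    adjAlpha ΔM ι St (f * z) = adjAlpha ΔM ι St f * (z ⊗ₜ 1) := by
  suffices f ∈ LinearMap.ker (adjAlpha ΔM ι St ∘ₗ LinearMap.mulRight ℂ z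
      - LinearMap.mulRight ℂ (z ⊗ₜ[ℂ] (1 : G)) ∘ₗ adjAlpha ΔM ι St) by
    simpa [sub_eq_zero] using this
  refine entries.induction_left H.gen _ ?_ (fun i j f hf => ?_) f
  · simp [H.adjAlpha_one, hz]
  · simp only [LinearMap.mem_ker, LinearMap.sub_apply, LinearMap.comp_apply,
      LinearMap.mulRight_apply, sub_eq_zero] at hf ⊢
    rw [mul_assoc, H.adjAlpha_mul, H.adjAlpha_mul, hf]
    have : ∀ g, (1 ⊗ₜ g) * (z ⊗ₜ[ℂ] (1 : G)) = (z ⊗ₜ 1) * (1 ⊗ₜ g) := by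
      simp [Algebra.TensorProduct.tmul_mul_tmul]
    simp only [Finset.sum_mul, mul_assoc, this]

end IsQuantumGroup

/-- The left ideal generated by the differences of the basic coinvariants and their values. -/
def coinvIdeal {M : Type} [Ring M] [Algebra ℂ M] (q : ℂ) (x : Fin 2 → Fin 2 → M)
    (e : M →ₐ[ℂ] ℂ) : Submodule ℂ M :=
  Submodule.span ℂ {y : M | ∃ h : M,
    y = h * ((x 0 0 + x 1 1) - algebraMap ℂ M (e (x 0 0 + x 1 1))) ∨
    y = h * (det₂ q x - algebraMap ℂ M (e (det₂ q x)))}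

theorem mul_trace_sub_mem {M : Type} [Ring M] [Algebra ℂ M] (q : ℂ) (x : Fin 2 → Fin 2 → M)
    (e : M →ₐ[ℂ] ℂ) (f : M) :
    f * (x 0 0 + x 1 1) - e (x 0 0 + x 1 1) • f ∈ coinvIdeal q x e := by
  refine Submodule.subset_span ⟨f, Or.inl ?_⟩
  rw [mul_sub, Algebra.algebraMap_eq_smul_one, mul_smul_comm, mul_one]

theorem mul_det_sub_mem {M : Type} [Ring M] [Algebra ℂ M] (q : ℂ) (x : Fin 2 → Fin 2 → M)
    (e : M →ₐ[ℂ] ℂ) (f : M) :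
    f * det₂ q x - e (det₂ q x) • f ∈ coinvIdeal q x e := by
  refine Submodule.subset_span ⟨f, Or.inr ?_⟩
  rw [mul_sub, Algebra.algebraMap_eq_smul_one, mul_smul_comm, mul_one]

/-- To map the left ideal into a subspace it is enough to be linear over right multiplication by
the basic coinvariants. -/
theorem coinvIdeal_le_comap {M N : Type} [Ring M] [Algebra ℂ M] [AddCommGroup N] [Module ℂ N]
    {q : ℂ} {x : Fin 2 → Fin 2 → M} {e : M →ₐ[ℂ] ℂ} {W : Submodule ℂ N} (T : M →ₗ[ℂ] N)
    (h1 : ∀ f, T (f * (x 0 0 + x 1 1)) - e (x 0 0 + x 1 1) • T f ∈ W)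
    (h2 : ∀ f, T (f * det₂ q x) - e (det₂ q x) • T f ∈ W) : coinvIdeal q x e ≤ W.comap T := by
  refine Submodule.span_le.2 ?_
  rintro _ ⟨f, rfl | rfl⟩
  · simpa [mul_sub, Algebra.algebraMap_eq_smul_one] using h1 f
  · simpa [mul_sub, Algebra.algebraMap_eq_smul_one] using h2 f

theorem mul_mem_coinvIdeal {M : Type} [Ring M] [Algebra ℂ M] {q : ℂ} {x : Fin 2 → Fin 2 → M}
    {e : M →ₐ[ℂ] ℂ} (g : M) {f : M} (hf : f ∈ coinvIdeal q x e) : g * f ∈ coinvIdeal q x e := by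
  refine (coinvIdeal_le_comap (W := coinvIdeal q x e) (LinearMap.mulLeft ℂ g)
    (fun f => ?_) (fun f => ?_)) hf
  · simpa [mul_assoc] using mul_trace_sub_mem q x e (g * f)
  · simpa [mul_assoc] using mul_det_sub_mem q x e (g * f)

namespace IsQuantumGroup

variable {M G : Type} [Ring M] [Algebra ℂ M] [Ring G] [Algebra ℂ G] {q : ℂ}
  {x : Fin 2 → Fin 2 → M} {y : Fin 2 → Fin 2 → G} {δ : G} {ι : M →ₐ[ℂ] G}
  {ΔM : M →ₐ[ℂ] M ⊗[ℂ] M} {ΔG : G →ₐ[ℂ] G ⊗[ℂ] G} {εG : G →ₐ[ℂ] ℂ} {St : G →ₗ[ℂ] G}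
  {ξ : Fin 2 → ℂ} {e : M →ₐ[ℂ] ℂ}

theorem coorbit_one (H : IsQuantumGroup q x y δ ι ΔM ΔG εG St) :
    coorbit e (adjAlpha ΔM ι St) 1 = 1 := by
  simp [coorbit, H.adjAlpha_one]

theorem coorbit_mul (H : IsQuantumGroup q x y δ ι ΔM ΔG εG St)
    (he : ∀ i j, e (x i j) = if i = j then ξ i else 0) (i j : Fin 2) (f : M) :
    coorbit e (adjAlpha ΔM ι St) (x i j * f)
      = ∑ k, ξ k • (y k j * coorbit e (adjAlpha ΔM ι St) f * St (y i k)) := by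
  have key : ∀ k l (w : M ⊗[ℂ] G) (g g' : G), TensorProduct.lid ℂ G (TensorProduct.map
      e.toLinearMap LinearMap.id ((x k l ⊗ₜ g) * w * (1 ⊗ₜ g')))
      = e (x k l) • (g * (TensorProduct.lid ℂ G (TensorProduct.map
      e.toLinearMap LinearMap.id w)) * g') := by
    intro k l w g g'
    induction w with
    | zero => simp
    | add a b ha hb => simp only [mul_add, add_mul, map_add, ha, hb, smul_add]
    | tmul u v =>
      simp [Algebra.TensorProduct.tmul_mul_tmul, smul_smul]
  simp only [coorbit, LinearMap.comp_apply, H.adjAlpha_mul, map_sum, LinearEquiv.coe_coe, key, he]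
  refine Finset.sum_congr rfl fun k _ => ?_
  simp [ite_smul]

theorem coorbit_mul_eq_conj (H : IsQuantumGroup q x y δ ι ΔM ΔG εG St)
    (he : ∀ i j, e (x i j) = if i = j then ξ i else 0) (i j : Fin 2) (f : M) :
    coorbit e (adjAlpha ΔM ι St) (x i j * f) = (![1, -q] : Fin 2 → ℂ) i •
      IsQuantumGL.conj q (ξ 0) (ξ 1) y δ j (1 - i) (coorbit e (adjAlpha ΔM ι St) f) := by
  have hq := H.gl.ne
  obtain ⟨h1, h2, h3, h4⟩ := H.antipode_entries
  rw [H.coorbit_mul he, Fin.sum_univ_two, IsQuantumGL.conj]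
  fin_cases i <;>
  · simp only [Fin.zero_eta, Fin.mk_one, h1, h2, h3, h4, mul_smul_comm, ← mul_assoc, sub_zero,
      sub_self, Matrix.cons_val_zero, Matrix.cons_val_one]
    match_scalars <;> field_simp

theorem coinvIdeal_le_ker (H : IsQuantumGroup q x y δ ι ΔM ΔG εG St) :
    coinvIdeal q x e ≤ LinearMap.ker (coorbit e (adjAlpha ΔM ι St)) := by
  have key : ∀ z f, adjAlpha ΔM ι St z = z ⊗ₜ 1 → coorbit e (adjAlpha ΔM ι St) (f * z)
      - e z • coorbit e (adjAlpha ΔM ι St) f = 0 := by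
    intro z f hz
    have : ∀ w : M ⊗[ℂ] G, TensorProduct.lid ℂ G (TensorProduct.map
        e.toLinearMap LinearMap.id (w * (z ⊗ₜ 1)))
        = e z • TensorProduct.lid ℂ G (TensorProduct.map e.toLinearMap LinearMap.id w) := by
      intro w
      induction w with
      | zero => simp
      | add a b ha hb => simp only [add_mul, map_add, ha, hb, smul_add]
      | tmul u v => simp [Algebra.TensorProduct.tmul_mul_tmul, smul_smul, mul_comm]
    simp only [coorbit, LinearMap.comp_apply, H.adjAlpha_mul_coinvariant hz, LinearEquiv.coe_coe,
      this, sub_self]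
  rw [← Submodule.comap_bot]
  exact coinvIdeal_le_comap _ (fun f => key _ f H.adjAlpha_trace) fun f => key _ f H.adjAlpha_det

theorem comul_antipode (H : IsQuantumGroup q x y δ ι ΔM ΔG εG St) (i j : Fin 2) :
    ΔG (St (y i j)) = ∑ k, St (y k j) ⊗ₜ[ℂ] St (y i k) := by
  have hq := H.gl.ne
  obtain ⟨h1, h2, h3, h4⟩ := H.antipode_entries
  fin_cases i <;> fin_cases j <;>
  · simp only [Fin.zero_eta, Fin.mk_one, h1, h2, h3, h4, map_smul, map_mul, H.comul, H.comul_inv,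
      Fin.sum_univ_two, add_mul, Algebra.TensorProduct.tmul_mul_tmul, TensorProduct.tmul_smul,
      ← TensorProduct.smul_tmul', smul_smul, smul_add]
    match_scalars <;> field_simp

/-- The co-orbit map is a morphism of comodules. -/
theorem map_coorbit_adjAlpha (H : IsQuantumGroup q x y δ ι ΔM ΔG εG St)
    (he : ∀ i j, e (x i j) = if i = j then ξ i else 0) (f : M) :
    (coorbit e (adjAlpha ΔM ι St)).rTensor G (adjAlpha ΔM ι St f)
      = ΔG (coorbit e (adjAlpha ΔM ι St) f) := by
  suffices f ∈ LinearMap.ker ((coorbit e (adjAlpha ΔM ι St)).rTensor G ∘ₗ adjAlpha ΔM ι St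
      - ΔG.toLinearMap ∘ₗ coorbit e (adjAlpha ΔM ι St)) by
    simpa [sub_eq_zero] using this
  refine entries.induction_left H.gen _ ?_ (fun i j f hf => ?_) f
  · simp [H.adjAlpha_one, H.coorbit_one, Algebra.TensorProduct.one_def]
  · simp only [LinearMap.mem_ker, LinearMap.sub_apply, LinearMap.comp_apply,
      AlgHom.toLinearMap_apply, sub_eq_zero] at hf ⊢
    have key : ∀ k l (w : M ⊗[ℂ] G) (g g' : G), (coorbit e (adjAlpha ΔM ι St)).rTensor G
        ((x k l ⊗ₜ g) * w * (1 ⊗ₜ g')) = ∑ r, ξ r • ((y r l ⊗ₜ g) *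
          (coorbit e (adjAlpha ΔM ι St)).rTensor G w * (St (y k r) ⊗ₜ g')) := by
      intro k l w g g'
      induction w with
      | zero => simp
      | add a b ha hb =>
        simp only [mul_add, add_mul, map_add, ha, hb, smul_add, Finset.sum_add_distrib]
      | tmul u v =>
        simp only [Algebra.TensorProduct.tmul_mul_tmul, LinearMap.rTensor_tmul, mul_one,
          H.coorbit_mul he, TensorProduct.sum_tmul, TensorProduct.smul_tmul']
    rw [H.adjAlpha_mul, H.coorbit_mul he]
    simp only [map_sum, key, hf, map_smul, map_mul, H.comul, H.comul_antipode, Finset.sum_mul,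
      Finset.mul_sum, Finset.smul_sum]
    simp only [Fin.sum_univ_two]
    abel

theorem adjAlpha_mem_of_mem_ker (H : IsQuantumGroup q x y δ ι ΔM ΔG εG St)
    (he : ∀ i j, e (x i j) = if i = j then ξ i else 0) {f : M}
    (hf : f ∈ LinearMap.ker (coorbit e (adjAlpha ΔM ι St))) :
    adjAlpha ΔM ι St f ∈ LinearMap.range (TensorProduct.map
      (LinearMap.ker (coorbit e (adjAlpha ΔM ι St))).subtype (LinearMap.id : G →ₗ[ℂ] G)) := by
  refine (Module.Flat.rTensor_exact G
    (LinearMap.exact_subtype_ker_map (coorbit e (adjAlpha ΔM ι St))) _).1 ?_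
  rw [H.map_coorbit_adjAlpha he, LinearMap.mem_ker.1 hf, map_zero]

end IsQuantumGroup

theorem pow_mul_of_mul_eq_smul {R : Type} [Ring R] [Algebra ℂ R] {f g : R} {c : ℂ}
    (h : f * g = c • (g * f)) (n : ℕ) : f * g ^ n = c ^ n • (g ^ n * f) := by
  induction n with
  | zero => simp
  | succ n ih =>
    rw [pow_succ, ← mul_assoc, ih, smul_mul_assoc, mul_assoc, h, mul_smul_comm, smul_smul,
      mul_assoc, ← pow_succ]

namespace IsQuantumGroup

variable {M G : Type} [Ring M] [Algebra ℂ M] [Ring G] [Algebra ℂ G] {q : ℂ}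
  {x : Fin 2 → Fin 2 → M} {y : Fin 2 → Fin 2 → G} {δ : G} {ι : M →ₐ[ℂ] G}
  {ΔM : M →ₐ[ℂ] M ⊗[ℂ] M} {ΔG : G →ₐ[ℂ] G ⊗[ℂ] G} {εG : G →ₐ[ℂ] ℂ} {St : G →ₗ[ℂ] G}
  {ξ : Fin 2 → ℂ} {e : M →ₐ[ℂ] ℂ}

theorem coorbit_pow (H : IsQuantumGroup q x y δ ι ΔM ΔG εG St)
    (he : ∀ i j, e (x i j) = if i = j then ξ i else 0) (n : ℕ) :
    coorbit e (adjAlpha ΔM ι St) (x 1 0 ^ n)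
      = (∏ k ∈ Finset.range n, (-q ^ (k + 1) * (ξ 0 - (q ^ (2 * k + 2))⁻¹ * ξ 1))) •
        (y 0 0 * y 1 0 * δ) ^ n := by
  have hq := H.gl.ne
  induction n with
  | zero => simp [H.coorbit_one]
  | succ n ih =>
    have ha : y 0 0 * (y 0 0 * y 1 0 * δ) = q • ((y 0 0 * y 1 0 * δ) * y 0 0) := by
      simp only [mul_assoc, H.gl.inv_comm, H.gl.ac', smul_mul_assoc, mul_smul_comm]
    have hc : y 1 0 * (y 0 0 * y 1 0 * δ) = q⁻¹ • ((y 0 0 * y 1 0 * δ) * y 1 0) := by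
      simp only [mul_assoc, H.gl.inv_comm, H.gl.ac', smul_mul_assoc, mul_smul_comm, smul_smul]
      match_scalars
      field_simp
    rw [Finset.prod_range_succ]
    generalize ∏ k ∈ Finset.range n, (-q ^ (k + 1) * (ξ 0 - (q ^ (2 * k + 2))⁻¹ * ξ 1)) = P at ih ⊢
    rw [pow_succ', H.coorbit_mul_eq_conj he, ih]
    simp only [IsQuantumGL.conj, sub_self, Matrix.cons_val_one, Matrix.cons_val_fin_one,
      mul_smul_comm, smul_mul_assoc, pow_mul_of_mul_eq_smul ha, pow_mul_of_mul_eq_smul hc]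
    have hac : (y 0 0 * y 1 0 * δ) ^ n * y 0 0 * y 1 0 * δ = (y 0 0 * y 1 0 * δ) ^ (n + 1) := by
      simp only [pow_succ, mul_assoc]
    have hca : (y 0 0 * y 1 0 * δ) ^ n * y 1 0 * y 0 0 * δ
        = q⁻¹ • (y 0 0 * y 1 0 * δ) ^ (n + 1) := by
      simp only [pow_succ, mul_assoc, H.gl.ac', mul_smul_comm, smul_smul, inv_mul_cancel₀ hq,
        one_smul]
    rw [hac, hca]
    match_scalars
    simp only [inv_pow]
    field_simp
    ring

theorem comodGen_le_ker (H : IsQuantumGroup q x y δ ι ΔM ΔG εG St)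
    (he : ∀ i j, e (x i j) = if i = j then ξ i else 0) {m : ℕ}
    (hξ : ξ 0 - (q ^ (2 * m + 2))⁻¹ * ξ 1 = 0) :
    comodGen (adjAlpha ΔM ι St) {f : M | ∃ k : ℕ, m < k ∧ f = x 1 0 ^ k}
      ≤ LinearMap.ker (coorbit e (adjAlpha ΔM ι St)) := by
  refine sInf_le ⟨?_, fun f hf => H.adjAlpha_mem_of_mem_ker he hf⟩
  rintro _ ⟨k, hk, rfl⟩
  rw [SetLike.mem_coe, LinearMap.mem_ker, H.coorbit_pow he,
    Finset.prod_eq_zero (Finset.mem_range.2 hk) (by rw [hξ, mul_zero]), zero_smul]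

end IsQuantumGroup

/-- Monomials multiplied by polynomials with nonzero constant terms are linearly independent. -/
theorem linearIndependent_monomial_mul {I : Type} (s : I → Fin 2 →₀ ℕ)
    (hs : Function.Injective s) (p : I → MvPolynomial (Fin 2) ℂ)
    (hp : ∀ i, (p i).coeff 0 ≠ 0) :
    LinearIndependent ℂ fun i => MvPolynomial.monomial (s i) 1 * p i := by
  classical
  rw [linearIndependent_iff']
  intro T g hg
  by_contra! hne
  obtain ⟨i₀, hi₀, hmin⟩ := (T.filter fun i => g i ≠ 0).exists_min_image (fun i => (s i).degree) (by
    obtain ⟨i, hi, hgi⟩ := hne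
    exact ⟨i, Finset.mem_filter.2 ⟨hi, hgi⟩⟩)
  rw [Finset.mem_filter] at hi₀
  have hc := congr(MvPolynomial.coeff (s i₀) $hg)
  rw [MvPolynomial.coeff_sum, MvPolynomial.coeff_zero, Finset.sum_eq_single_of_mem i₀ hi₀.1,
    MvPolynomial.coeff_smul, MvPolynomial.coeff_monomial_mul', if_pos le_rfl, tsub_self, one_mul,
    smul_eq_mul] at hc
  · exact (mul_ne_zero hi₀.2 (hp i₀)) hc
  · intro i hi hne
    rw [MvPolynomial.coeff_smul, MvPolynomial.coeff_monomial_mul']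
    split_ifs with hle
    · by_cases hgi : g i = 0
      · rw [hgi, zero_smul]
      · refine absurd (hmin i (Finset.mem_filter.2 ⟨hi, hgi⟩)) (not_le.2 ?_)
        have hlt : s i < s i₀ := lt_of_le_of_ne hle fun h => hne (hs h)
        have hadd : s i₀ = s i + (s i₀ - s i) := (add_tsub_cancel_of_le hle).symm
        rw [hadd, map_add]
        have : (s i₀ - s i).degree ≠ 0 := by
          rw [Ne, Finsupp.degree_eq_zero_iff, tsub_eq_zero_iff_le]
          exact not_le_of_gt hlt
        lia
    · rw [smul_zero]

/-- The entries of a representation of quantum matrices on functions `ℤ → ℂ[B, C]`. -/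
def shiftRep (q : ℂ) : Fin 2 → Fin 2 → Module.End ℂ (ℤ → MvPolynomial (Fin 2) ℂ) :=
  ![![LinearMap.funLeft ℂ (MvPolynomial (Fin 2) ℂ) fun n : ℤ => n + 1,
      LinearMap.pi fun n : ℤ =>
        q ^ n • LinearMap.mulLeft ℂ (MvPolynomial.X 0) ∘ₗ LinearMap.proj n],
    ![LinearMap.pi fun n : ℤ =>
        q ^ n • LinearMap.mulLeft ℂ (MvPolynomial.X 1) ∘ₗ LinearMap.proj n,
      LinearMap.pi fun n : ℤ => LinearMap.mulLeft ℂ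
        (1 + q ^ (2 * n - 1) • (MvPolynomial.X 0 * MvPolynomial.X 1)) ∘ₗ
          LinearMap.proj (n - 1)]]

section shiftRep

variable {q : ℂ} (f : ℤ → MvPolynomial (Fin 2) ℂ) (n : ℤ)

theorem shiftRep_00 : shiftRep q 0 0 f n = f (n + 1) := rfl

theorem shiftRep_01 : shiftRep q 0 1 f n = q ^ n • (MvPolynomial.X 0 * f n) := rfl

theorem shiftRep_10 : shiftRep q 1 0 f n = q ^ n • (MvPolynomial.X 1 * f n) := rfl

theorem shiftRep_11 : shiftRep q 1 1 f n
    = (1 + q ^ (2 * n - 1) • (MvPolynomial.X 0 * MvPolynomial.X 1)) * f (n - 1) := rfl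

theorem shiftRep_00_11 (hq : q ≠ 0) : shiftRep q 0 0 (shiftRep q 1 1 f) n
    = (1 + (q ^ n * q ^ n * q) • (MvPolynomial.X 0 * MvPolynomial.X 1)) * f n := by
  rw [shiftRep_00, shiftRep_11, add_sub_cancel_right,
    show 2 * (n + 1) - 1 = n + n + 1 by ring, zpow_add₀ hq, zpow_add₀ hq, zpow_one]

theorem shiftRep_11_00 (hq : q ≠ 0) : shiftRep q 1 1 (shiftRep q 0 0 f) n
    = (1 + (q ^ n * q ^ n * q⁻¹) • (MvPolynomial.X 0 * MvPolynomial.X 1)) * f n := by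
  rw [shiftRep_11, shiftRep_00, sub_add_cancel,
    show 2 * n - 1 = n + n + -1 by ring, zpow_add₀ hq, zpow_add₀ hq, zpow_neg_one]

end shiftRep

theorem isQuantumMatrix_shiftRep {q : ℂ} (hq : q ≠ 0) : IsQuantumMatrix q (shiftRep q) := by
  constructor <;>
  · refine LinearMap.ext fun f => funext fun n => ?_
    simp only [Module.End.mul_apply, LinearMap.smul_apply, LinearMap.sub_apply, Pi.smul_apply,
      Pi.sub_apply, shiftRep_00_11 _ _ hq, shiftRep_11_00 _ _ hq]
    simp only [shiftRep_00, shiftRep_01, shiftRep_10, shiftRep_11, MvPolynomial.smul_eq_C_mul,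
      zpow_add₀ hq, zpow_sub₀ hq, zpow_one, map_mul, map_sub, div_eq_mul_inv]
    ring

theorem det_shiftRep {q : ℂ} (hq : q ≠ 0) : det₂ q (shiftRep q) = 1 := by
  refine LinearMap.ext fun f => funext fun n => ?_
  simp only [det₂, Module.End.mul_apply, LinearMap.smul_apply, LinearMap.sub_apply, Pi.smul_apply,
    Pi.sub_apply, shiftRep_00_11 _ _ hq, Module.End.one_apply]
  simp only [shiftRep_01, shiftRep_10, MvPolynomial.smul_eq_C_mul, map_mul]
  ring

/-- Functions whose values have lowest term a nonzero multiple of `B ^ r * C ^ s`. -/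
def HasLowestTerm (r s : ℕ) (f : ℤ → MvPolynomial (Fin 2) ℂ) : Prop :=
  ∀ n, ∃ p : MvPolynomial (Fin 2) ℂ, p.coeff 0 ≠ 0 ∧
    f n = MvPolynomial.X 0 ^ r * MvPolynomial.X 1 ^ s * p

section HasLowestTerm

variable {q : ℂ} {r s : ℕ} {f : ℤ → MvPolynomial (Fin 2) ℂ}

theorem HasLowestTerm.shiftRep_00 (hf : HasLowestTerm r s f) :
    HasLowestTerm r s (shiftRep q 0 0 f) :=
  fun n => hf (n + 1)

theorem HasLowestTerm.shiftRep_01 (hq : q ≠ 0) (hf : HasLowestTerm r s f) :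
    HasLowestTerm (r + 1) s (shiftRep q 0 1 f) := by
  intro n
  obtain ⟨p, hp, h⟩ := hf n
  refine ⟨q ^ n • p, ?_, ?_⟩
  · rw [MvPolynomial.coeff_smul, smul_eq_mul]
    exact mul_ne_zero (zpow_ne_zero n hq) hp
  · rw [_root_.shiftRep_01, h, mul_smul_comm]
    ring_nf

theorem HasLowestTerm.shiftRep_10 (hq : q ≠ 0) (hf : HasLowestTerm r s f) :
    HasLowestTerm r (s + 1) (shiftRep q 1 0 f) := by
  intro n
  obtain ⟨p, hp, h⟩ := hf n
  refine ⟨q ^ n • p, ?_, ?_⟩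
  · rw [MvPolynomial.coeff_smul, smul_eq_mul]
    exact mul_ne_zero (zpow_ne_zero n hq) hp
  · rw [_root_.shiftRep_10, h, mul_smul_comm]
    ring_nf

theorem HasLowestTerm.shiftRep_11 (hf : HasLowestTerm r s f) :
    HasLowestTerm r s (shiftRep q 1 1 f) := by
  intro n
  obtain ⟨p, hp, h⟩ := hf (n - 1)
  refine ⟨(1 + q ^ (2 * n - 1) • (MvPolynomial.X 0 * MvPolynomial.X 1)) * p, ?_, ?_⟩
  · rw [← MvPolynomial.constantCoeff_eq] at hp ⊢
    simpa [MvPolynomial.smul_eq_C_mul] using hp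
  · rw [_root_.shiftRep_11, h]
    ring

end HasLowestTerm

namespace IsQuantumGroup

variable {M G : Type} [Ring M] [Algebra ℂ M] [Ring G] [Algebra ℂ G] {q : ℂ}
  {x : Fin 2 → Fin 2 → M} {y : Fin 2 → Fin 2 → G} {δ : G} {ι : M →ₐ[ℂ] G}
  {ΔM : M →ₐ[ℂ] M ⊗[ℂ] M} {ΔG : G →ₐ[ℂ] G ⊗[ℂ] G} {εG : G →ₐ[ℂ] ℂ} {St : G →ₗ[ℂ] G}

theorem map_inv_eq_one (H : IsQuantumGroup q x y δ ι ΔM ΔG εG St) {B : Type} [Ring B] [Algebra ℂ B]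
    {z : Fin 2 → Fin 2 → B} (hz : det₂ q z = 1) (ψ : G →ₐ[ℂ] B) (hψ : ∀ i j, ψ (y i j) = z i j) :
    ψ δ = 1 := by
  have hdet : ψ (det₂ q y) = 1 := by
    rw [← hz]
    simp only [det₂, map_sub, map_mul, map_smul, hψ]
  calc ψ δ = ψ δ * ψ (det₂ q y) := by rw [hdet, mul_one]
    _ = 1 := by rw [← map_mul, H.gl.mul_det, map_one]

theorem sq_le_finrank_torusInv (H : IsQuantumGroup q x y δ ι ΔM ΔG εG St) (n : ℕ) :
    (n + 1) ^ 2 ≤ Module.finrank ℂ ↥(torusInv y δ ^ n) := by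
  have hq := H.gl.ne
  obtain ⟨ψ, hψ⟩ := H.lift _ (shiftRep q) (isQuantumMatrix_shiftRep hq) (det_shiftRep hq)
  have hδ := H.map_inv_eq_one (det_shiftRep hq) ψ hψ
  let E : Fin (n + 1) × Fin (n + 1) → G := fun p =>
    if p.1.1 ≤ p.2.1 then (y 0 0 * y 1 0 * δ) ^ (p.2.1 - p.1.1) * (y 0 1 * y 1 0 * δ) ^ p.1.1
    else (y 0 1 * y 1 1 * δ) ^ (p.1.1 - p.2.1) * (y 0 1 * y 1 0 * δ) ^ p.2.1
  have hmem : ∀ p, E p ∈ torusInv y δ ^ n := by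
    rintro ⟨⟨i, hi⟩, ⟨j, hj⟩⟩
    have hpow : ∀ k l r s, r + s ≤ n →
        (y 0 k * y 1 l * δ) ^ r * (y 0 1 * y 1 0 * δ) ^ s ∈ torusInv y δ ^ n := by
      intro k l r s hrs
      refine IsQuantumGL.pow_mono hrs ?_
      rw [pow_add]
      exact Submodule.mul_mem_mul
        (Submodule.pow_mem_pow (torusInv y δ) (IsQuantumGL.mem_torusInv k l) _)
        (Submodule.pow_mem_pow (torusInv y δ) (IsQuantumGL.mem_torusInv 1 0) _)
    dsimp only [E]
    split_ifs with h
    · exact hpow _ _ _ _ (by lia)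
    · exact hpow _ _ _ _ (by lia)
  have hlow : ∀ p, HasLowestTerm p.1.1 p.2.1 (ψ (E p) 1) := by
    have h1 : HasLowestTerm 0 0 1 := fun n => ⟨1, by simp, by simp⟩
    have hu : ∀ k {r s f}, HasLowestTerm r s f →
        HasLowestTerm r (s + k) (ψ ((y 0 0 * y 1 0 * δ) ^ k) f) := by
      intro k r s f hf
      induction k with
      | zero => simpa using hf
      | succ k ih =>
        rw [pow_succ']
        simpa [hψ, hδ, ← add_assoc] using (ih.shiftRep_10 hq).shiftRep_00 (q := q)
    have hv : ∀ k {r s f}, HasLowestTerm r s f →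
        HasLowestTerm (r + k) (s + k) (ψ ((y 0 1 * y 1 0 * δ) ^ k) f) := by
      intro k r s f hf
      induction k with
      | zero => simpa using hf
      | succ k ih =>
        rw [pow_succ']
        simpa [hψ, hδ, ← add_assoc] using (ih.shiftRep_10 hq).shiftRep_01 hq
    have hw : ∀ k {r s f}, HasLowestTerm r s f →
        HasLowestTerm (r + k) s (ψ ((y 0 1 * y 1 1 * δ) ^ k) f) := by
      intro k r s f hf
      induction k with
      | zero => simpa using hf
      | succ k ih =>
        rw [pow_succ']
        simpa [hψ, hδ, ← add_assoc] using (ih.shiftRep_11 (q := q)).shiftRep_01 hq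
    rintro ⟨⟨i, hi⟩, ⟨j, hj⟩⟩
    dsimp only [E]
    split_ifs with h
    · convert hu (j - i) (hv i h1) using 1
      · lia
      · lia
      · rw [map_mul, Module.End.mul_apply]
    · convert hw (i - j) (hv j h1) using 1
      · lia
      · lia
      · rw [map_mul, Module.End.mul_apply]
  choose p hp hEp using fun k => hlow k 0
  have hind : LinearIndependent ℂ E := by
    let Λ : G →ₗ[ℂ] MvPolynomial (Fin 2) ℂ :=
      LinearMap.proj 0 ∘ₗ LinearMap.applyₗ (1 : ℤ → MvPolynomial (Fin 2) ℂ) ∘ₗ ψ.toLinearMap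
    refine LinearIndependent.of_comp Λ ?_
    convert linearIndependent_monomial_mul
      (fun k : Fin (n + 1) × Fin (n + 1) =>
        Finsupp.single 0 k.1.1 + Finsupp.single 1 k.2.1) ?_ p hp using 1
    · funext k
      refine (hEp k).trans ?_
      rw [MvPolynomial.X_pow_eq_monomial, MvPolynomial.X_pow_eq_monomial,
        MvPolynomial.monomial_mul, mul_one]
    · intro k l hkl
      have h0 := DFunLike.congr_fun hkl 0
      have h1 := DFunLike.congr_fun hkl 1
      simp at h0 h1
      exact Prod.ext (Fin.ext h0) (Fin.ext h1)
  have hfin : Module.Finite ℂ ↥(torusInv y δ ^ n) :=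
    Module.Finite.iff_fg.2 (Submodule.FG.pow (Submodule.fg_span (Set.toFinite _)) n)
  have hind' : LinearIndependent ℂ fun k => (⟨E k, hmem k⟩ : ↥(torusInv y δ ^ n)) :=
    LinearIndependent.of_comp (torusInv y δ ^ n).subtype hind
  simpa [sq] using hind'.fintype_card_le_finrank

end IsQuantumGroup

/-- The span of the monomials of degree at most `n` in `x₁₂`, `x₂₁`, `x₁₁` whose degree in `x₁₁` is
at most one. -/
def normalMonomials {R : Type} [Ring R] [Algebra ℂ R] (x : Fin 2 → Fin 2 → R) (n : ℕ) :
    Submodule ℂ R :=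
  Submodule.span ℂ {f | ∃ j k, (j + k ≤ n ∧ f = x 0 1 ^ j * x 1 0 ^ k) ∨
    (j + k + 1 ≤ n ∧ f = x 0 1 ^ j * x 1 0 ^ k * x 0 0)}

namespace normalMonomials

variable {R : Type} [Ring R] [Algebra ℂ R] {q : ℂ} {x : Fin 2 → Fin 2 → R}

theorem mem {j k n : ℕ} (h : j + k ≤ n) : x 0 1 ^ j * x 1 0 ^ k ∈ normalMonomials x n :=
  Submodule.subset_span ⟨j, k, Or.inl ⟨h, rfl⟩⟩

theorem mem' {j k n : ℕ} (h : j + k + 1 ≤ n) :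
    x 0 1 ^ j * x 1 0 ^ k * x 0 0 ∈ normalMonomials x n :=
  Submodule.subset_span ⟨j, k, Or.inr ⟨h, rfl⟩⟩

theorem mono {m n : ℕ} (h : m ≤ n) : normalMonomials x m ≤ normalMonomials x n := by
  refine Submodule.span_mono ?_
  rintro _ ⟨j, k, ⟨hjk, rfl⟩ | ⟨hjk, rfl⟩⟩
  · exact ⟨j, k, Or.inl ⟨hjk.trans h, rfl⟩⟩
  · exact ⟨j, k, Or.inr ⟨hjk.trans h, rfl⟩⟩

theorem exists_range (n : ℕ) : ∃ F : Fin (n + 1) × Fin (n + 1) → R,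
    normalMonomials x n ≤ Submodule.span ℂ (Set.range F) := by
  refine ⟨fun p => if p.1.1 ≤ p.2.1 then x 0 1 ^ p.1.1 * x 1 0 ^ (p.2.1 - p.1.1)
    else x 0 1 ^ p.2.1 * x 1 0 ^ (p.1.1 - 1 - p.2.1) * x 0 0, ?_⟩
  refine Submodule.span_mono ?_
  rintro _ ⟨j, k, ⟨hjk, rfl⟩ | ⟨hjk, rfl⟩⟩
  · refine ⟨(⟨j, by lia⟩, ⟨j + k, by lia⟩), ?_⟩
    simp
  · refine ⟨(⟨j + k + 1, by lia⟩, ⟨j, by lia⟩), ?_⟩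
    dsimp only
    rw [if_neg (by lia), show j + k + 1 - 1 - j = k by lia]

theorem finite (n : ℕ) : Module.Finite ℂ (normalMonomials x n) := by
  obtain ⟨F, hF⟩ := exists_range (x := x) n
  have := FiniteDimensional.span_of_finite ℂ (Set.finite_range F)
  exact Submodule.finiteDimensional_of_le hF

theorem finrank_le (n : ℕ) : Module.finrank ℂ (normalMonomials x n) ≤ (n + 1) ^ 2 := by
  obtain ⟨F, hF⟩ := exists_range (x := x) n
  have := FiniteDimensional.span_of_finite ℂ (Set.finite_range F)
  calc Module.finrank ℂ (normalMonomials x n) ≤ _ := Submodule.finrank_mono hF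
    _ ≤ Fintype.card (Fin (n + 1) × Fin (n + 1)) := finrank_range_le_card F
    _ = (n + 1) ^ 2 := by simp [sq]

end normalMonomials

theorem IsQuantumMatrix.b_mul {R : Type} [Ring R] {x : Fin 2 → Fin 2 → R} (j k : ℕ) (f : R) :
    x 0 1 * (x 0 1 ^ j * x 1 0 ^ k * f) = x 0 1 ^ (j + 1) * x 1 0 ^ k * f := by
  simp only [pow_succ', mul_assoc]

namespace IsQuantumMatrix

variable {R : Type} [Ring R] [Algebra ℂ R] {q : ℂ} {x : Fin 2 → Fin 2 → R}

theorem a_mul (h : IsQuantumMatrix q x) (j k : ℕ) (f : R) :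
    x 0 0 * (x 0 1 ^ j * x 1 0 ^ k * f) = q ^ (j + k) • (x 0 1 ^ j * x 1 0 ^ k * (x 0 0 * f)) := by
  rw [← mul_assoc, ← mul_assoc, pow_mul_of_mul_eq_smul h.ab, smul_mul_assoc, mul_assoc (x 0 1 ^ j),
    pow_mul_of_mul_eq_smul h.ac, mul_smul_comm, smul_smul, ← pow_add, smul_mul_assoc]
  simp only [mul_assoc]

theorem d_mul (h : IsQuantumMatrix q x) (j k : ℕ) (f : R) :
    x 1 1 * (x 0 1 ^ j * x 1 0 ^ k * f)
      = q⁻¹ ^ (j + k) • (x 0 1 ^ j * x 1 0 ^ k * (x 1 1 * f)) := by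
  rw [← mul_assoc, ← mul_assoc, pow_mul_of_mul_eq_smul h.db, smul_mul_assoc, mul_assoc (x 0 1 ^ j),
    pow_mul_of_mul_eq_smul h.dc, mul_smul_comm, smul_smul, ← pow_add, smul_mul_assoc]
  simp only [mul_assoc]

theorem c_mul (h : IsQuantumMatrix q x) (j k : ℕ) (f : R) :
    x 1 0 * (x 0 1 ^ j * x 1 0 ^ k * f) = x 0 1 ^ j * x 1 0 ^ (k + 1) * f := by
  have : Commute (x 1 0) (x 0 1 ^ j) := Commute.pow_right h.cb j
  rw [← mul_assoc, ← mul_assoc, this.eq, mul_assoc (x 0 1 ^ j), ← pow_succ']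

theorem mul_bc (h : IsQuantumMatrix q x) (j k : ℕ) :
    x 0 1 ^ j * x 1 0 ^ k * (x 0 1 * x 1 0) = x 0 1 ^ (j + 1) * x 1 0 ^ (k + 1) := by
  have : Commute (x 1 0 ^ k) (x 0 1) := Commute.pow_left h.cb k
  rw [mul_assoc, ← mul_assoc (x 1 0 ^ k), this.eq, pow_succ, pow_succ]
  simp only [mul_assoc]

theorem mul_da_mem (h : IsQuantumMatrix q x) (e : R →ₐ[ℂ] ℂ) (f : R) :
    f * (x 1 1 * x 0 0) - q⁻¹ • (f * (x 0 1 * x 1 0)) - e (det₂ q x) • f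
      ∈ coinvIdeal q x e := by
  convert mul_det_sub_mem q x e f using 2
  rw [h.da, det₂, mul_sub, mul_sub, mul_smul_comm, mul_smul_comm]
  module

theorem mul_aa_mem (e : R →ₐ[ℂ] ℂ) (f : R) :
    f * (x 0 0 * x 0 0) + q • (f * (x 0 1 * x 1 0)) + e (det₂ q x) • f
      - e (x 0 0 + x 1 1) • (f * x 0 0) ∈ coinvIdeal q x e := by
  convert sub_mem (mul_trace_sub_mem q x e (f * x 0 0)) (mul_det_sub_mem q x e f) using 1
  rw [det₂, mul_sub, mul_add, mul_smul_comm]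
  simp only [mul_assoc]
  abel

/-- Modulo the left ideal of the basic coinvariants, every element is a combination of the
monomials `x₁₂ ^ j * x₂₁ ^ k` and `x₁₂ ^ j * x₂₁ ^ k * x₁₁`. -/
theorem entries_pow_le_sup (h : IsQuantumMatrix q x) (e : R →ₐ[ℂ] ℂ) (n : ℕ) :
    entries x ^ n ≤ coinvIdeal q x e ⊔ normalMonomials x n := by
  induction n with
  | zero =>
    rw [pow_zero, Submodule.one_le]
    refine Submodule.mem_sup_right ?_
    simpa using normalMonomials.mem (x := x) (j := 0) (k := 0) le_rfl
  | succ n ih =>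
    have hle := sup_le_sup_left (normalMonomials.mono (x := x) n.le_succ) (coinvIdeal q x e)
    refine entries.succ_le (ih.trans hle) fun f hf r s => ?_
    have hmem : ∀ {g p : R}, p - g ∈ coinvIdeal q x e → g ∈ normalMonomials x (n + 1) →
        p ∈ coinvIdeal q x e ⊔ normalMonomials x (n + 1) := fun {g p} hp hg =>
      sub_add_cancel p g ▸ add_mem (Submodule.mem_sup_left hp) (Submodule.mem_sup_right hg)
    suffices ∀ r s, normalMonomials x n ≤
        (coinvIdeal q x e ⊔ normalMonomials x (n + 1)).comap (LinearMap.mulLeft ℂ (x r s)) by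
      obtain ⟨g, hg, p, hp, rfl⟩ := Submodule.mem_sup.1 (ih hf)
      rw [mul_add]
      exact add_mem (Submodule.mem_sup_left (mul_mem_coinvIdeal _ hg)) (this r s hp)
    clear f hf r s
    intro r s
    refine Submodule.span_le.2 ?_
    rintro _ ⟨j, k, ⟨hjk, rfl⟩ | ⟨hjk, rfl⟩⟩ <;> rw [SetLike.mem_coe, Submodule.mem_comap,
      LinearMap.mulLeft_apply]
    · rw [← mul_one (x 0 1 ^ j * x 1 0 ^ k)]
      fin_cases r <;> fin_cases s <;> simp only [Fin.zero_eta, Fin.mk_one]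
      · rw [h.a_mul, mul_one]
        exact Submodule.mem_sup_right (Submodule.smul_mem _ _ (normalMonomials.mem' (by lia)))
      · rw [b_mul, mul_one]
        exact Submodule.mem_sup_right (normalMonomials.mem (by lia))
      · rw [h.c_mul, mul_one]
        exact Submodule.mem_sup_right (normalMonomials.mem (by lia))
      · rw [h.d_mul, mul_one]
        refine Submodule.smul_mem _ _ (hmem (g := e (x 0 0 + x 1 1) • (x 0 1 ^ j * x 1 0 ^ k)
          - x 0 1 ^ j * x 1 0 ^ k * x 0 0) ?_ ?_)
        · convert mul_trace_sub_mem q x e (x 0 1 ^ j * x 1 0 ^ k) using 1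
          rw [mul_add]
          abel
        · exact sub_mem (Submodule.smul_mem _ _ (normalMonomials.mem (by lia)))
            (normalMonomials.mem' (by lia))
    · fin_cases r <;> fin_cases s <;> simp only [Fin.zero_eta, Fin.mk_one]
      · rw [h.a_mul]
        refine Submodule.smul_mem _ _ (hmem
          (g := e (x 0 0 + x 1 1) • (x 0 1 ^ j * x 1 0 ^ k * x 0 0)
            - q • (x 0 1 ^ (j + 1) * x 1 0 ^ (k + 1)) - e (det₂ q x) • (x 0 1 ^ j * x 1 0 ^ k)) ?_ ?_)
        · convert mul_aa_mem (q := q) e (x 0 1 ^ j * x 1 0 ^ k) using 1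
          rw [h.mul_bc]
          abel
        · exact sub_mem (sub_mem (Submodule.smul_mem _ _ (normalMonomials.mem' (by lia)))
            (Submodule.smul_mem _ _ (normalMonomials.mem (by lia))))
            (Submodule.smul_mem _ _ (normalMonomials.mem (by lia)))
      · rw [b_mul]
        exact Submodule.mem_sup_right (normalMonomials.mem' (by lia))
      · rw [h.c_mul]
        exact Submodule.mem_sup_right (normalMonomials.mem' (by lia))
      · rw [h.d_mul]
        refine Submodule.smul_mem _ _ (hmem (g := q⁻¹ • (x 0 1 ^ (j + 1) * x 1 0 ^ (k + 1))
          + e (det₂ q x) • (x 0 1 ^ j * x 1 0 ^ k)) ?_ ?_)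
        · convert h.mul_da_mem e (x 0 1 ^ j * x 1 0 ^ k) using 1
          rw [h.mul_bc]
          abel
        · exact add_mem (Submodule.smul_mem _ _ (normalMonomials.mem (by lia)))
            (Submodule.smul_mem _ _ (normalMonomials.mem (by lia)))

end IsQuantumMatrix

theorem mem_of_map_eq_zero {R S : Type} [AddCommGroup R] [Module ℂ R] [AddCommGroup S] [Module ℂ S]
    (φ : R →ₗ[ℂ] S) {K P E : Submodule ℂ R} {T : Submodule ℂ S} [Module.Finite ℂ P]
    (hK : K ≤ LinearMap.ker φ) (hdim : Module.finrank ℂ P ≤ Module.finrank ℂ T)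
    (hT : T ≤ E.map φ) (hE : E ≤ K ⊔ P) {f : R} (hf : f ∈ K ⊔ P) (hφ : φ f = 0) : f ∈ K := by
  have hTP : T ≤ LinearMap.range (φ.domRestrict P) := by
    refine hT.trans ?_
    rintro _ ⟨g, hg, rfl⟩
    obtain ⟨a, ha, p, hp, rfl⟩ := Submodule.mem_sup.1 (hE hg)
    refine ⟨⟨p, hp⟩, ?_⟩
    rw [LinearMap.domRestrict_apply, map_add, LinearMap.mem_ker.1 (hK ha), zero_add]
  have hker : LinearMap.ker (φ.domRestrict P) = ⊥ := by
    rw [← Submodule.finrank_eq_zero (R := ℂ)]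
    have h1 := LinearMap.finrank_range_add_finrank_ker (φ.domRestrict P)
    have h2 := Submodule.finrank_mono hTP
    lia
  obtain ⟨a, ha, p, hp, rfl⟩ := Submodule.mem_sup.1 hf
  rw [map_add, LinearMap.mem_ker.1 (hK ha), zero_add] at hφ
  obtain rfl : p = 0 := congrArg Subtype.val (LinearMap.ker_eq_bot'.1 hker ⟨p, hp⟩ hφ)
  simpa using ha

/-- The action of a functional on a right comodule. -/
def functionalAct {M G : Type} [AddCommGroup M] [Module ℂ M] [AddCommGroup G] [Module ℂ G]
    (α : M →ₗ[ℂ] M ⊗[ℂ] G) (φ : G →ₗ[ℂ] ℂ) : M →ₗ[ℂ] M :=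
  (TensorProduct.rid ℂ M).toLinearMap ∘ₗ TensorProduct.map LinearMap.id φ ∘ₗ α

theorem functionalAct_mem_comodGen {M G : Type} [Ring M] [Algebra ℂ M] [Ring G] [Algebra ℂ G]
    (α : M →ₗ[ℂ] M ⊗[ℂ] G) (φ : G →ₗ[ℂ] ℂ) (s : Set M) {f : M} (hf : f ∈ comodGen α s) :
    functionalAct α φ f ∈ comodGen α s := by
  rw [comodGen, Submodule.mem_sInf] at hf ⊢
  intro W hW
  obtain ⟨w, hw⟩ := hW.2 f (hf W hW)
  rw [functionalAct, LinearMap.comp_apply, LinearMap.comp_apply, ← hw]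
  clear hw
  induction w with
  | zero => simp
  | add a b ha hb => simpa only [map_add] using add_mem ha hb
  | tmul u v => simpa using W.smul_mem (φ v) u.2

/-- The entries of a triangular representation of quantum matrices. -/
def triangularRep (q : ℂ) : Fin 2 → Fin 2 → Matrix (Fin 2) (Fin 2) ℂ :=
  ![![!![1, 0; 0, q⁻¹], 0], ![!![0, 1; 0, 0], !![1, 0; 0, q]]]

theorem isQuantumMatrix_triangularRep {q : ℂ} (hq : q ≠ 0) :
    IsQuantumMatrix q (triangularRep q) := by
  constructor <;>
  · ext i j
    fin_cases i <;> fin_cases j <;> simp [triangularRep, hq]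

theorem det_triangularRep {q : ℂ} (hq : q ≠ 0) : det₂ q (triangularRep q) = 1 := by
  ext i j
  fin_cases i <;> fin_cases j <;> simp [triangularRep, det₂, hq]

theorem geom_sum_sq_ne_zero {q : ℂ} (hq : (∀ n : ℕ, 0 < n → q ^ n ≠ 1) ∨ q = 1) {n : ℕ}
    (hn : n ≠ 0) : ∑ i ∈ Finset.range n, (q ^ 2) ^ i ≠ 0 := by
  obtain hq | rfl := hq
  · intro h
    have := geom_sum_mul (q ^ 2) n
    rw [h, zero_mul, eq_comm, sub_eq_zero, ← pow_mul] at this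
    exact hq _ (by lia) this
  · simpa using hn

theorem sum_pow_add_inv_pow_mul {q : ℂ} (hq : q ≠ 0) (k : ℕ) :
    (∑ i ∈ Finset.range k, (q ^ (2 * i + 2) + (q ^ (2 * i))⁻¹)) * q ^ (2 * k)
      = q ^ 2 * ∑ i ∈ Finset.range (2 * k), (q ^ 2) ^ i := by
  induction k with
  | zero => simp
  | succ k ih =>
    rw [Finset.sum_range_succ, show 2 * (k + 1) = 2 * k + 1 + 1 by ring, geom_sum_succ,
      Finset.sum_range_succ, ← pow_mul, mul_add, add_mul, pow_succ, pow_succ, ← mul_assoc,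
      ← mul_assoc, ih]
    field_simp
    ring

theorem add_sum_pow_add_inv_pow_mul {q : ℂ} (hq : q ≠ 0) (k : ℕ) :
    (q + ∑ i ∈ Finset.range k, (q ^ (2 * i + 3) + (q ^ (2 * i + 1))⁻¹)) * q ^ (2 * k)
      = q * ∑ i ∈ Finset.range (2 * k + 1), (q ^ 2) ^ i := by
  induction k with
  | zero => simp
  | succ k ih =>
    rw [Finset.sum_range_succ, ← add_assoc, show 2 * (k + 1) = 2 * k + 1 + 1 by ring, geom_sum_succ,
      Finset.sum_range_succ, ← pow_mul, mul_add, add_mul, pow_succ, pow_succ, ← mul_assoc,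
      ← mul_assoc, ih]
    field_simp
    ring

namespace IsQuantumGroup

variable {M G : Type} [Ring M] [Algebra ℂ M] [Ring G] [Algebra ℂ G] {q : ℂ}
  {x : Fin 2 → Fin 2 → M} {y : Fin 2 → Fin 2 → G} {δ : G} {ι : M →ₐ[ℂ] G}
  {ΔM : M →ₐ[ℂ] M ⊗[ℂ] M} {ΔG : G →ₐ[ℂ] G ⊗[ℂ] G} {εG : G →ₐ[ℂ] ℂ} {St : G →ₗ[ℂ] G}
  {ξ : Fin 2 → ℂ} {e : M →ₐ[ℂ] ℂ}

theorem functionalAct_mul_coinvariant (H : IsQuantumGroup q x y δ ι ΔM ΔG εG St)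
    (φ : G →ₗ[ℂ] ℂ) {z : M} (hz : adjAlpha ΔM ι St z = z ⊗ₜ 1) (f : M) :
    functionalAct (adjAlpha ΔM ι St) φ (f * z) = functionalAct (adjAlpha ΔM ι St) φ f * z := by
  simp only [functionalAct, LinearMap.comp_apply, H.adjAlpha_mul_coinvariant hz]
  generalize adjAlpha ΔM ι St f = w
  induction w with
  | zero => simp
  | add a b ha hb => simp only [add_mul, map_add, ha, hb]
  | tmul u v => simp [Algebra.TensorProduct.tmul_mul_tmul]

theorem functionalAct_mem_coinvIdeal (H : IsQuantumGroup q x y δ ι ΔM ΔG εG St)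
    (φ : G →ₗ[ℂ] ℂ) {f : M} (hf : f ∈ coinvIdeal q x e) :
    functionalAct (adjAlpha ΔM ι St) φ f ∈ coinvIdeal q x e := by
  refine (coinvIdeal_le_comap (W := coinvIdeal q x e) _ (fun f => ?_) fun f => ?_) hf
  · rw [H.functionalAct_mul_coinvariant φ H.adjAlpha_trace]
    exact mul_trace_sub_mem _ _ _ _
  · rw [H.functionalAct_mul_coinvariant φ H.adjAlpha_det]
    exact mul_det_sub_mem _ _ _ _

/-- The matrix coefficients of a representation act on products through the coproduct. -/
theorem functionalAct_coeff_mul (H : IsQuantumGroup q x y δ ι ΔM ΔG εG St)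
    (ρ : G →ₐ[ℂ] Matrix (Fin 2) (Fin 2) ℂ) (i j r s : Fin 2) (f : M) :
    functionalAct (adjAlpha ΔM ι St) (Matrix.entryLinearMap ℂ ℂ r s ∘ₗ ρ.toLinearMap) (x i j * f)
      = ∑ k, ∑ l, ∑ p, ∑ t, (ρ (y l j) r p * ρ (St (y i k)) t s) • (x k l *
        functionalAct (adjAlpha ΔM ι St) (Matrix.entryLinearMap ℂ ℂ p t ∘ₗ ρ.toLinearMap) f) := by
  simp only [functionalAct, LinearMap.comp_apply, H.adjAlpha_mul, map_sum]
  refine Finset.sum_congr rfl fun k _ => Finset.sum_congr rfl fun l _ => ?_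
  generalize adjAlpha ΔM ι St f = w
  induction w with
  | zero => simp
  | add a b ha hb => simp only [add_mul, mul_add, map_add, ha, hb, smul_add, Finset.sum_add_distrib]
  | tmul u v =>
    simp only [Algebra.TensorProduct.tmul_mul_tmul, TensorProduct.map_tmul, LinearMap.id_apply,
      LinearMap.comp_apply, AlgHom.toLinearMap_apply, map_mul, Matrix.entryLinearMap_apply,
      LinearEquiv.coe_coe, TensorProduct.rid_tmul, mul_one, Matrix.mul_apply, Fin.sum_univ_two,
      mul_smul_comm, smul_smul, ← add_smul]
    congr 1
    ring

/-- The two operators `E` and `θ` on `M` given by the matrix coefficients of a triangular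
representation. -/
theorem exists_operators (H : IsQuantumGroup q x y δ ι ΔM ΔG εG St) :
    ∃ (φ φ' : G →ₗ[ℂ] ℂ) (E θ : M →ₗ[ℂ] M), E = functionalAct (adjAlpha ΔM ι St) φ ∧
      θ = functionalAct (adjAlpha ΔM ι St) φ' ∧ E 1 = 0 ∧ θ 1 = 1 ∧
      (∀ f, E (x 0 0 * f) = q • (x 0 0 * E f) + q • (x 0 1 * θ f)) ∧
      (∀ f, E (x 0 1 * f) = q • (x 0 1 * E f)) ∧
      (∀ f, E (x 1 0 * f) = q⁻¹ • (x 1 0 * E f) - q • (x 0 0 * f) + q⁻¹ • (x 1 1 * θ f)) ∧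
      (∀ f, θ (x 0 0 * f) = x 0 0 * θ f) ∧
      (∀ f, θ (x 1 0 * f) = (q⁻¹ * q⁻¹) • (x 1 0 * θ f)) := by
  have hq := H.gl.ne
  obtain ⟨ρ, hρ⟩ := H.lift _ (triangularRep q) (isQuantumMatrix_triangularRep hq)
    (det_triangularRep hq)
  have hδ := H.map_inv_eq_one (det_triangularRep hq) ρ hρ
  obtain ⟨h1, h2, h3, h4⟩ := H.antipode_entries
  have hS : ∀ i j, ρ (St (y i j)) = ![![triangularRep q 1 1, -q⁻¹ • triangularRep q 0 1],
      ![-q • triangularRep q 1 0, triangularRep q 0 0]] i j := by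
    intro i j
    fin_cases i <;> fin_cases j <;> simp [h1, h2, h3, h4, hρ, hδ]
  obtain ⟨T, hT⟩ : ∃ T : Fin 2 → Fin 2 → M →ₗ[ℂ] M, ∀ r s, T r s = functionalAct
      (adjAlpha ΔM ι St) (Matrix.entryLinearMap ℂ ℂ r s ∘ₗ ρ.toLinearMap) := ⟨_, fun _ _ => rfl⟩
  have hmul := H.functionalAct_coeff_mul ρ
  simp only [← hT, hρ, hS, Fin.sum_univ_two] at hmul
  have hone : ∀ r s, T r s 1 = (1 : Matrix (Fin 2) (Fin 2) ℂ) r s • (1 : M) := by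
    intro r s
    simp [hT, functionalAct, H.adjAlpha_one]
  have h10 : ∀ f, T 1 0 f = 0 := by
    intro f
    rw [← LinearMap.mem_ker]
    refine entries.induction_left H.gen _ (by simp [hone]) (fun i j f hf => ?_) f
    rw [LinearMap.mem_ker] at hf ⊢
    rw [hmul]
    fin_cases i <;> fin_cases j <;> simp [triangularRep, hf]
  have h00 : ∀ f, T 0 0 f = f := by
    intro f
    rw [← sub_eq_zero]
    change (T 0 0 - (LinearMap.id : M →ₗ[ℂ] M)) f = 0
    rw [← LinearMap.mem_ker]
    refine entries.induction_left H.gen _ (by simp [hone]) (fun i j f hf => ?_) f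
    simp only [LinearMap.mem_ker, LinearMap.sub_apply, LinearMap.id_apply, sub_eq_zero] at hf ⊢
    rw [hmul]
    fin_cases i <;> fin_cases j <;> simp [triangularRep, hf, h10]
  refine ⟨_, _, T 0 1, T 1 1, hT 0 1, hT 1 1, by simp [hone], by simp [hone], ?_, ?_, ?_, ?_, ?_⟩ <;>
  · intro f
    rw [hmul]
    simp [triangularRep, h10, h00, hq]
    try abel

end IsQuantumGroup

namespace IsQuantumGroup

variable {M G : Type} [Ring M] [Algebra ℂ M] [Ring G] [Algebra ℂ G] {q : ℂ}
  {x : Fin 2 → Fin 2 → M} {y : Fin 2 → Fin 2 → G} {δ : G} {ι : M →ₐ[ℂ] G}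
  {ΔM : M →ₐ[ℂ] M ⊗[ℂ] M} {ΔG : G →ₐ[ℂ] G ⊗[ℂ] G} {εG : G →ₐ[ℂ] ℂ} {St : G →ₗ[ℂ] G}
  {ξ : Fin 2 → ℂ} {e : M →ₐ[ℂ] ℂ}

theorem functionalAct_mem_entries_pow (H : IsQuantumGroup q x y δ ι ΔM ΔG εG St)
    (φ : G →ₗ[ℂ] ℂ) {n : ℕ} {f : M} (hf : f ∈ entries x ^ n) :
    functionalAct (adjAlpha ΔM ι St) φ f ∈ entries x ^ n := by
  suffices ∀ n (φ : G →ₗ[ℂ] ℂ),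
      entries x ^ n ≤ (entries x ^ n).comap (functionalAct (adjAlpha ΔM ι St) φ) from
    this n φ hf
  clear hf f n φ
  intro n
  induction n with
  | zero =>
    intro φ
    rw [pow_zero, Submodule.one_le, Submodule.mem_comap]
    have h1 : (1 : M) ∈ (1 : Submodule ℂ M) := Submodule.one_le.1 le_rfl
    simpa [functionalAct, H.adjAlpha_one] using Submodule.smul_mem _ (φ 1) h1
  | succ n ih =>
    intro φ
    refine entries.succ_le (fun f hf => entries.le_succ n (ih φ hf)) fun f hf i j => ?_
    rw [Submodule.mem_comap, functionalAct, LinearMap.comp_apply, LinearMap.comp_apply,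
      H.adjAlpha_mul]
    simp only [map_sum]
    refine sum_mem fun k _ => sum_mem fun l _ => ?_
    have key : ∀ w : M ⊗[ℂ] G, TensorProduct.rid ℂ M (TensorProduct.map LinearMap.id φ
        ((x k l ⊗ₜ y l j) * w * (1 ⊗ₜ St (y i k)))) = x k l * TensorProduct.rid ℂ M
        (TensorProduct.map LinearMap.id
          (φ ∘ₗ LinearMap.mulRight ℂ (St (y i k)) ∘ₗ LinearMap.mulLeft ℂ (y l j)) w) := by
      intro w
      induction w with
      | zero => simp
      | add a b ha hb => simp only [add_mul, mul_add, map_add, ha, hb]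
      | tmul u v => simp [Algebra.TensorProduct.tmul_mul_tmul]
    rw [LinearEquiv.coe_coe, key]
    exact entries.mul_mem k l (ih _ hf)

theorem exists_lowering (H : IsQuantumGroup q x y δ ι ΔM ΔG εG St)
    (hq : (∀ n : ℕ, 0 < n → q ^ n ≠ 1) ∨ q = 1) (e : M →ₐ[ℂ] ℂ) :
    ∃ (φ : G →ₗ[ℂ] ℂ) (E : M →ₗ[ℂ] M), E = functionalAct (adjAlpha ΔM ι St) φ ∧
      (∀ j f, E (x 0 1 ^ j * f) = q ^ j • (x 0 1 ^ j * E f)) ∧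
      (∀ k, ∃ c : ℂ, c ≠ 0 ∧ E (x 1 0 ^ (k + 1)) - c • (x 1 0 ^ k * x 0 0)
        ∈ coinvIdeal q x e ⊔ entries x ^ k) ∧
      (∀ k, ∃ c : ℂ, c ≠ 0 ∧ E (x 1 0 ^ k * x 0 0) - c • (x 0 1 * x 1 0 ^ k)
        ∈ coinvIdeal q x e ⊔ entries x ^ k) := by
  have hq0 := H.gl.ne
  have hM := H.mat
  obtain ⟨φ, φ', E, θ, hE, hθ, hE1, hθ1, hEa, hEb, hEc, hθa, hθc⟩ := H.exists_operators
  have hθpow : ∀ k f, θ (x 1 0 ^ k * f) = (q⁻¹ * q⁻¹) ^ k • (x 1 0 ^ k * θ f) := by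
    intro k f
    induction k with
    | zero => simp
    | succ k ih =>
      rw [pow_succ', mul_assoc, hθc, ih, mul_smul_comm, smul_smul, ← pow_succ', mul_assoc]
  have hc : ∀ k, x 1 0 ^ k ∈ entries x ^ k := fun k => Submodule.pow_mem_pow _ (entries.mem 1 0) k
  have hmul : ∀ i j k f, f ∈ coinvIdeal q x e ⊔ entries x ^ k →
      x i j * f ∈ coinvIdeal q x e ⊔ entries x ^ (k + 1) := by
    intro i j k f hf
    obtain ⟨g, hg, p, hp, rfl⟩ := Submodule.mem_sup.1 hf
    rw [mul_add]
    exact add_mem (Submodule.mem_sup_left (mul_mem_coinvIdeal _ hg))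
      (Submodule.mem_sup_right (entries.mul_mem _ _ hp))
  have hac : ∀ k f, x 0 0 * (x 1 0 ^ k * f) = q ^ k • (x 1 0 ^ k * (x 0 0 * f)) := by
    intro k f
    simpa using hM.a_mul 0 k f
  have hdc : ∀ k f, x 1 1 * (x 1 0 ^ k * f) = q⁻¹ ^ k • (x 1 0 ^ k * (x 1 1 * f)) := by
    intro k f
    simpa using hM.d_mul 0 k f
  have hcc : ∀ k f, x 1 0 * (x 1 0 ^ k * f) = x 1 0 ^ (k + 1) * f := by
    intro k f
    rw [← mul_assoc, ← pow_succ']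
  have hcb : ∀ k, x 1 0 * (x 0 1 * x 1 0 ^ k) = x 0 1 * x 1 0 ^ (k + 1) := by
    intro k
    rw [hM.cb', ← pow_succ']
  have hcbc : ∀ k, x 1 0 ^ k * (x 0 1 * x 1 0) = x 0 1 * x 1 0 ^ (k + 1) := by
    intro k
    simpa using hM.mul_bc 0 k
  refine ⟨φ, E, hE, fun j f => ?_, fun k => ?_, fun k => ?_⟩
  · induction j with
    | zero => simp
    | succ j ih =>
      rw [pow_succ', mul_assoc, hEb, ih, mul_smul_comm, smul_smul, ← pow_succ', mul_assoc]
  · suffices E (x 1 0 ^ (k + 1)) - (-(q ^ (k + 1))⁻¹ *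
        ∑ i ∈ Finset.range (k + 1), (q ^ (2 * i + 2) + (q ^ (2 * i))⁻¹)) • (x 1 0 ^ k * x 0 0)
        ∈ coinvIdeal q x e ⊔ entries x ^ k by
      refine ⟨_, mul_ne_zero (neg_ne_zero.2 (inv_ne_zero (pow_ne_zero _ hq0))) ?_, this⟩
      refine left_ne_zero_of_mul (b := q ^ (2 * (k + 1))) ?_
      rw [sum_pow_add_inv_pow_mul hq0]
      exact mul_ne_zero (pow_ne_zero _ hq0) (geom_sum_sq_ne_zero hq (by lia))
    have hrec : ∀ k, E (x 1 0 ^ (k + 1)) = q⁻¹ • (x 1 0 * E (x 1 0 ^ k))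
        - (q * q ^ k) • (x 1 0 ^ k * x 0 0)
        + (q⁻¹ * ((q⁻¹ * q⁻¹) ^ k * q⁻¹ ^ k)) • (x 1 0 ^ k * x 1 1) := by
      intro k
      have h1 := hθpow k 1
      have h2 := hac k 1
      have h3 := hdc k 1
      simp only [mul_one, hθ1] at h1 h2 h3
      rw [pow_succ', hEc, h1, h2, mul_smul_comm, h3, smul_smul, smul_smul, smul_smul, mul_assoc]
    have hd : ∀ k, x 1 0 ^ k * (x 0 0 + x 1 1) ∈ coinvIdeal q x e ⊔ entries x ^ k := by
      intro k
      rw [← sub_add_cancel (x 1 0 ^ k * (x 0 0 + x 1 1)) (e (x 0 0 + x 1 1) • x 1 0 ^ k)]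
      exact add_mem (Submodule.mem_sup_left (mul_trace_sub_mem _ _ _ _))
        (Submodule.mem_sup_right (Submodule.smul_mem _ _ (hc k)))
    induction k with
    | zero =>
      convert Submodule.smul_mem _ q⁻¹ (hd 0) using 1
      rw [hrec]
      simp [hE1]
      match_scalars <;> (try simp only [inv_pow, mul_pow]) <;> field_simp <;> ring
    | succ k ih =>
      convert add_mem (Submodule.smul_mem _ q⁻¹ (hmul 1 0 _ _ ih)) (Submodule.smul_mem _
        (q⁻¹ * ((q⁻¹ * q⁻¹) ^ (k + 1) * q⁻¹ ^ (k + 1))) (hd (k + 1))) using 1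
      rw [hrec, Finset.sum_range_succ _ (k + 1), mul_sub, mul_smul_comm, hcc]
      generalize ∑ i ∈ Finset.range (k + 1), (q ^ (2 * i + 2) + (q ^ (2 * i))⁻¹) = S
      rw [mul_add (x 1 0 ^ (k + 1))]
      match_scalars <;> (try simp only [inv_pow, mul_pow]) <;> field_simp <;> ring
  · suffices E (x 1 0 ^ k * x 0 0) - ((q ^ k)⁻¹ * (q +
        ∑ i ∈ Finset.range k, (q ^ (2 * i + 3) + (q ^ (2 * i + 1))⁻¹))) • (x 0 1 * x 1 0 ^ k)
        ∈ coinvIdeal q x e ⊔ entries x ^ k by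
      refine ⟨_, mul_ne_zero (inv_ne_zero (pow_ne_zero _ hq0)) ?_, this⟩
      refine left_ne_zero_of_mul (b := q ^ (2 * k)) ?_
      rw [add_sum_pow_add_inv_pow_mul hq0]
      exact mul_ne_zero hq0 (geom_sum_sq_ne_zero hq (by lia))
    have hθa1 : θ (x 0 0) = x 0 0 := by simpa [hθ1] using hθa 1
    have hrec : ∀ k, E (x 1 0 ^ (k + 1) * x 0 0) = q⁻¹ • (x 1 0 * E (x 1 0 ^ k * x 0 0))
        - (q * q ^ k) • (x 1 0 ^ k * (x 0 0 * x 0 0))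
        + (q⁻¹ * ((q⁻¹ * q⁻¹) ^ k * q⁻¹ ^ k)) • (x 1 0 ^ k * (x 1 1 * x 0 0)) := by
      intro k
      rw [pow_succ', mul_assoc, hEc, hθpow, hθa1, hac, mul_smul_comm, hdc, smul_smul, smul_smul,
        smul_smul, mul_assoc]
    have hca : ∀ k, x 1 0 ^ k * x 0 0 ∈ entries x ^ (k + 1) := by
      intro k
      rw [pow_succ]
      exact Submodule.mul_mem_mul (hc k) (entries.mem 0 0)
    have haa : ∀ k, x 1 0 ^ k * (x 0 0 * x 0 0) + q • (x 0 1 * x 1 0 ^ (k + 1))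
        ∈ coinvIdeal q x e ⊔ entries x ^ (k + 1) := by
      intro k
      have h1 := Submodule.mem_sup_left (T := entries x ^ (k + 1))
        (IsQuantumMatrix.mul_aa_mem (q := q) (x := x) e (x 1 0 ^ k))
      have h2 := Submodule.mem_sup_right (S := coinvIdeal q x e)
        (sub_mem (Submodule.smul_mem _ (e (x 0 0 + x 1 1)) (hca k))
          (Submodule.smul_mem _ (e (det₂ q x)) (entries.le_succ k (hc k))))
      convert add_mem h1 h2 using 1
      rw [hcbc]
      abel
    have hda : ∀ k, x 1 0 ^ k * (x 1 1 * x 0 0) - q⁻¹ • (x 0 1 * x 1 0 ^ (k + 1))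
        ∈ coinvIdeal q x e ⊔ entries x ^ (k + 1) := by
      intro k
      have h1 := Submodule.mem_sup_left (T := entries x ^ (k + 1)) (hM.mul_da_mem e (x 1 0 ^ k))
      have h2 := Submodule.mem_sup_right (S := coinvIdeal q x e)
        (Submodule.smul_mem _ (e (det₂ q x)) (entries.le_succ k (hc k)))
      convert add_mem h1 h2 using 1
      rw [hcbc]
      abel
    induction k with
    | zero =>
      convert zero_mem (coinvIdeal q x e ⊔ entries x ^ 0) using 1
      have := hEa 1
      simp only [mul_one, hE1, hθ1, mul_zero, smul_zero, zero_add] at this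
      simp [this]
    | succ k ih =>
      convert add_mem (sub_mem (Submodule.smul_mem _ q⁻¹ (hmul 1 0 _ _ ih)) (Submodule.smul_mem _
        (q * q ^ k) (haa k))) (Submodule.smul_mem _ (q⁻¹ * ((q⁻¹ * q⁻¹) ^ k * q⁻¹ ^ k))
          (hda k)) using 1
      rw [hrec, Finset.sum_range_succ _ k, mul_sub, mul_smul_comm, hcb]
      generalize ∑ i ∈ Finset.range k, (q ^ (2 * i + 3) + (q ^ (2 * i + 1))⁻¹) = S
      match_scalars <;> (try simp only [inv_pow, mul_pow]) <;> field_simp <;> ring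

theorem entries_pow_succ_le (H : IsQuantumGroup q x y δ ι ΔM ΔG εG St)
    (hq : (∀ n : ℕ, 0 < n → q ^ n ≠ 1) ∨ q = 1) (e : M →ₐ[ℂ] ℂ) (s : Set M) {n : ℕ}
    (hs : x 1 0 ^ (n + 1) ∈ s) :
    entries x ^ (n + 1) ≤
      coinvIdeal q x e ⊔ comodGen (adjAlpha ΔM ι St) s ⊔ entries x ^ n := by
  have hq0 := H.gl.ne
  obtain ⟨φ, E, hE, hEb, hEc, hEca⟩ := H.exists_lowering hq e
  set U := coinvIdeal q x e ⊔ comodGen (adjAlpha ΔM ι St) s ⊔ entries x ^ n with hU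
  have hEU : ∀ f ∈ U, E f ∈ U := by
    intro f hf
    obtain ⟨g, hg, r, hr, rfl⟩ := Submodule.mem_sup.1 hf
    obtain ⟨p, hp, v, hv, rfl⟩ := Submodule.mem_sup.1 hg
    rw [map_add, map_add, hE]
    exact add_mem (Submodule.mem_sup_left (add_mem
      (Submodule.mem_sup_left (H.functionalAct_mem_coinvIdeal φ hp))
      (Submodule.mem_sup_right (functionalAct_mem_comodGen (adjAlpha ΔM ι St) φ s hv))))
      (Submodule.mem_sup_right (H.functionalAct_mem_entries_pow φ hr))
  have hmul : ∀ j k f, j + k = n → f ∈ coinvIdeal q x e ⊔ entries x ^ k → x 0 1 ^ j * f ∈ U := by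
    rintro j k f rfl hf
    obtain ⟨g, hg, p, hp, rfl⟩ := Submodule.mem_sup.1 hf
    rw [mul_add]
    refine add_mem (Submodule.mem_sup_left (Submodule.mem_sup_left (mul_mem_coinvIdeal _ hg)))
      (Submodule.mem_sup_right ?_)
    rw [pow_add]
    exact Submodule.mul_mem_mul (Submodule.pow_mem_pow _ (entries.mem 0 1) j) hp
  have hstep : ∀ j k f g, j + k = n → x 0 1 ^ j * f ∈ U →
      (∃ c : ℂ, c ≠ 0 ∧ E f - c • g ∈ coinvIdeal q x e ⊔ entries x ^ k) → x 0 1 ^ j * g ∈ U := by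
    rintro j k f g hjk hf ⟨c, hc, hg⟩
    have h1 := hEU _ hf
    rw [hEb, Submodule.smul_mem_iff _ (pow_ne_zero _ hq0)] at h1
    have h2 := sub_mem h1 (hmul j k _ hjk hg)
    rwa [mul_sub, sub_sub_cancel, mul_smul_comm, Submodule.smul_mem_iff _ hc] at h2
  have hbc : ∀ j k, j + k = n + 1 → x 0 1 ^ j * x 1 0 ^ k ∈ U := by
    intro j
    induction j with
    | zero =>
      rintro k hk
      obtain rfl : k = n + 1 := by lia
      rw [pow_zero, one_mul]
      refine Submodule.mem_sup_left (Submodule.mem_sup_right ?_)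
      exact (Submodule.mem_sInf.2 fun W hW => hW.1 hs)
    | succ j ih =>
      intro k hk
      have h := hstep j k _ _ (by lia)
        (hstep j k _ _ (by lia) (ih (k + 1) (by lia)) (hEc k)) (hEca k)
      rwa [← mul_assoc, ← pow_succ] at h
  refine (H.mat.entries_pow_le_sup e (n + 1)).trans
    (sup_le (le_sup_left.trans le_sup_left) (Submodule.span_le.2 ?_))
  have hlow : ∀ j k, x 0 1 ^ j * x 1 0 ^ k ∈ entries x ^ (j + k) := by
    intro j k
    rw [pow_add]
    exact Submodule.mul_mem_mul (Submodule.pow_mem_pow _ (entries.mem 0 1) j)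
      (Submodule.pow_mem_pow _ (entries.mem 1 0) k)
  rintro _ ⟨j, k, ⟨hjk, rfl⟩ | ⟨hjk, rfl⟩⟩
  · obtain hjk | hjk := hjk.eq_or_lt
    · exact hbc j k hjk
    · exact Submodule.mem_sup_right (entries.mono (by lia) (hlow j k))
  · obtain hjk | hjk := hjk.eq_or_lt
    · rw [SetLike.mem_coe, mul_assoc]
      exact hstep j k _ _ (by lia) (hbc j (k + 1) (by lia)) (hEc k)
    · refine Submodule.mem_sup_right (entries.mono (m := j + k + 1) (by lia) ?_)
      rw [pow_succ]
      exact Submodule.mul_mem_mul (hlow j k) (entries.mem 0 0)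

theorem entries_pow_le_of_comodGen (H : IsQuantumGroup q x y δ ι ΔM ΔG εG St)
    (hq : (∀ n : ℕ, 0 < n → q ^ n ≠ 1) ∨ q = 1) (e : M →ₐ[ℂ] ℂ) (m n : ℕ) :
    entries x ^ n ≤ coinvIdeal q x e ⊔
      comodGen (adjAlpha ΔM ι St) {f : M | ∃ k : ℕ, m < k ∧ f = x 1 0 ^ k} ⊔ entries x ^ m := by
  induction n with
  | zero => exact (entries.mono (Nat.zero_le m)).trans le_sup_right
  | succ n ih =>
    obtain h | h := le_or_gt (n + 1) m
    · exact (entries.mono h).trans le_sup_right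
    · exact (H.entries_pow_succ_le hq e {f : M | ∃ k : ℕ, m < k ∧ f = x 1 0 ^ k} ⟨n + 1, h, rfl⟩).trans
        (sup_le le_sup_left ih)

end IsQuantumGroup

/-- The coefficient of the constant monomial on the algebra of functions on the torus. -/
theorem exists_constantCoeff {D : Type} [CommRing D] [Algebra ℂ D] (t : Fin 2 → Dˣ)
    (hfree : ∀ (B : Type) [CommRing B] [Algebra ℂ B] (u : Fin 2 → Bˣ),
      ∃! φ : D →ₐ[ℂ] B, ∀ i, φ (t i : D) = (u i : B)) :
    ∃ κ : D →ₗ[ℂ] ℂ, κ 1 = 1 ∧ ∀ p r n : ℕ,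
      κ ((t 0 ^ p * t 1 ^ r * ((t 0)⁻¹ * (t 1)⁻¹) ^ n : Dˣ) : D) ≠ 0 → p = n ∧ r = n := by
  let g : Multiplicative (ℤ × ℤ) →* (AddMonoidAlgebra ℂ (ℤ × ℤ))ˣ :=
    (Units.map (AddMonoidAlgebra.of ℂ (ℤ × ℤ))).comp toUnits.toMonoidHom
  have hg : ∀ v, ((g v : (AddMonoidAlgebra ℂ (ℤ × ℤ))ˣ) : AddMonoidAlgebra ℂ (ℤ × ℤ))
      = AddMonoidAlgebra.single v.toAdd 1 := fun v => rfl
  let u : Fin 2 → Multiplicative (ℤ × ℤ) :=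
    ![Multiplicative.ofAdd (1, 0), Multiplicative.ofAdd (0, 1)]
  obtain ⟨φ, hφ, -⟩ := hfree (AddMonoidAlgebra ℂ (ℤ × ℤ)) fun i => g (u i)
  let κ : D →ₗ[ℂ] ℂ :=
    { toFun := fun d => (φ d).coeff 0
      map_add' := fun a b => by simp
      map_smul' := fun a b => by simp }
  have hκ : ∀ d, κ d = (φ d).coeff 0 := fun _ => rfl
  refine ⟨κ, ?_, fun p r n h => ?_⟩
  · rw [hκ, map_one, AddMonoidAlgebra.one_def]
    simp
  · have ht : ∀ i, Units.map φ.toMonoidHom (t i) = g (u i) := fun i => Units.ext (hφ i)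
    have hW : Units.map φ.toMonoidHom (t 0 ^ p * t 1 ^ r * ((t 0)⁻¹ * (t 1)⁻¹) ^ n)
        = g (u 0 ^ p * u 1 ^ r * ((u 0)⁻¹ * (u 1)⁻¹) ^ n) := by
      simp only [map_mul, map_pow, map_inv, ht]
    have hW' := congr((($hW : (AddMonoidAlgebra ℂ (ℤ × ℤ))ˣ) : AddMonoidAlgebra ℂ (ℤ × ℤ)))
    rw [hg] at hW'
    have hW'' : φ ((t 0 ^ p * t 1 ^ r * ((t 0)⁻¹ * (t 1)⁻¹) ^ n : Dˣ) : D) = _ := hW'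
    rw [hκ, hW''] at h
    have h0 : (u 0 ^ p * u 1 ^ r * ((u 0)⁻¹ * (u 1)⁻¹) ^ n).toAdd = 0 := by
      generalize (u 0 ^ p * u 1 ^ r * ((u 0)⁻¹ * (u 1)⁻¹) ^ n).toAdd = v at h
      by_contra hne
      exact h (by rw [AddMonoidAlgebra.coeff_single]; exact Finsupp.single_eq_of_ne (Ne.symm hne))
    have h1 := congrArg Prod.fst h0
    have h2 := congrArg Prod.snd h0
    simp [u] at h1 h2
    lia

/-- The span of the entries of a row. -/
def rowSpan {R : Type} [Ring R] [Algebra ℂ R] (x : Fin 2 → Fin 2 → R) (i : Fin 2) :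
    Submodule ℂ R :=
  Submodule.span ℂ (Set.range (x i))

theorem rowSpan_mul_le {R : Type} [Ring R] [Algebra ℂ R] {q : ℂ} {x : Fin 2 → Fin 2 → R}
    (h : IsQuantumMatrix q x) (hq : q ≠ 0) :
    rowSpan x 1 * rowSpan x 0 ≤ rowSpan x 0 * rowSpan x 1 := by
  have hmem : ∀ j k, x 0 j * x 1 k ∈ rowSpan x 0 * rowSpan x 1 := fun j k =>
    Submodule.mul_mem_mul (Submodule.subset_span ⟨j, rfl⟩) (Submodule.subset_span ⟨k, rfl⟩)
  rw [rowSpan, rowSpan, Submodule.span_mul_span, ← rowSpan, ← rowSpan, Submodule.span_le]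
  rintro _ ⟨_, ⟨j, rfl⟩, _, ⟨k, rfl⟩, rfl⟩
  fin_cases j <;> fin_cases k <;> simp only [SetLike.mem_coe, Fin.zero_eta, Fin.mk_one]
  · rw [← inv_smul_smul₀ hq (x 1 0 * x 0 0), ← h.ac]
    exact Submodule.smul_mem _ _ (hmem 0 0)
  · rw [h.cb]
    exact hmem 1 0
  · rw [h.da]
    exact sub_mem (hmem 0 1) (Submodule.smul_mem _ _ (hmem 1 0))
  · rw [h.db]
    exact Submodule.smul_mem _ _ (hmem 1 1)

theorem rowSpan_mul_pow_le {R : Type} [Ring R] [Algebra ℂ R] {q : ℂ} {x : Fin 2 → Fin 2 → R}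
    (h : IsQuantumMatrix q x) (hq : q ≠ 0) (p : ℕ) :
    rowSpan x 1 * rowSpan x 0 ^ p ≤ rowSpan x 0 ^ p * rowSpan x 1 := by
  induction p with
  | zero => simp
  | succ p ih =>
    calc rowSpan x 1 * rowSpan x 0 ^ (p + 1) = rowSpan x 1 * rowSpan x 0 ^ p * rowSpan x 0 := by
          rw [pow_succ, mul_assoc]
      _ ≤ rowSpan x 0 ^ p * rowSpan x 1 * rowSpan x 0 := mul_le_mul_left ih _
      _ = rowSpan x 0 ^ p * (rowSpan x 1 * rowSpan x 0) := mul_assoc _ _ _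
      _ ≤ rowSpan x 0 ^ p * (rowSpan x 0 * rowSpan x 1) := mul_le_mul_right (rowSpan_mul_le h hq) _
      _ = rowSpan x 0 ^ (p + 1) * rowSpan x 1 := by rw [pow_succ, mul_assoc]

namespace IsQuantumGL

variable {R : Type} [Ring R] [Algebra ℂ R] {q : ℂ} {x : Fin 2 → Fin 2 → R} {δ : R}

theorem rowSpan_le_torusInv_pow (h : IsQuantumGL q x δ) (n : ℕ) :
    ∀ f ∈ rowSpan x 0 ^ n * rowSpan x 1 ^ n, f * δ ^ n ∈ torusInv x δ ^ n := by
  induction n with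
  | zero => simp
  | succ n ih =>
    suffices rowSpan x 0 * (rowSpan x 0 ^ n * rowSpan x 1 ^ n) * rowSpan x 1 ≤
        (torusInv x δ ^ (n + 1)).comap (LinearMap.mulRight ℂ (δ ^ (n + 1))) by
      intro f hf
      refine this ?_
      rwa [pow_succ', pow_succ, ← mul_assoc, mul_assoc (rowSpan x 0)] at hf
    have hδ : ∀ k, Commute (x 1 k) (δ ^ n) := fun k => (Commute.pow_left (h.inv_comm 1 k) n).symm
    rw [Submodule.mul_le]
    intro g hg c hc
    refine Submodule.mul_induction_on hg (fun b hb f hf => ?_) fun a b ha hb => ?_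
    · induction hb using Submodule.span_induction with
      | zero => simp
      | add a b _ _ ha hb => rw [add_mul, add_mul]; exact add_mem ha hb
      | smul r a _ ha => rw [smul_mul_assoc, smul_mul_assoc]; exact Submodule.smul_mem _ _ ha
      | mem b hb =>
        obtain ⟨j, rfl⟩ := hb
        induction hc using Submodule.span_induction with
        | zero => simp
        | add a b _ _ ha hb => rw [mul_add]; exact add_mem ha hb
        | smul r a _ ha => rw [mul_smul_comm]; exact Submodule.smul_mem _ _ ha
        | mem c hc =>
          obtain ⟨k, rfl⟩ := hc
          rw [Submodule.mem_comap, LinearMap.mulRight_apply]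
          convert (h.sandwich_mem n _ (ih f hf)).1 j k using 1
          simp only [mul_assoc]
          rw [← mul_assoc (δ ^ n), ← (hδ k).eq, mul_assoc, ← pow_succ]
    · rw [add_mul]
      exact add_mem ha hb

theorem induction_rowSpan (h : IsQuantumGL q x δ)
    (hgen : Algebra.adjoin ℂ ((Set.range fun p : Fin 2 × Fin 2 => x p.1 p.2) ∪ {δ}) = ⊤)
    (W : Submodule ℂ R)
    (hW : ∀ p r n, ∀ f ∈ rowSpan x 0 ^ p * rowSpan x 1 ^ r, f * δ ^ n ∈ W) (f : R) : f ∈ W := by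
  let Z : Submodule ℂ R := Submodule.span ℂ
    {g | ∃ p r n, ∃ f ∈ rowSpan x 0 ^ p * rowSpan x 1 ^ r, g = f * δ ^ n}
  have hZ : Z ≤ W := by
    refine Submodule.span_le.2 ?_
    rintro _ ⟨p, r, n, f, hf, rfl⟩
    exact hW p r n f hf
  refine hZ ?_
  have hmul : ∀ g : R, (∀ p r n, ∀ f ∈ rowSpan x 0 ^ p * rowSpan x 1 ^ r, g * (f * δ ^ n) ∈ Z) →
      ∀ f ∈ Z, g * f ∈ Z := by
    intro g hg f hf
    suffices Z ≤ Z.comap (LinearMap.mulLeft ℂ g) from this hf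
    refine Submodule.span_le.2 ?_
    rintro _ ⟨p, r, n, f, hf, rfl⟩
    exact hg p r n f hf
  have hx : ∀ i j, ∀ f ∈ Z, x i j * f ∈ Z := by
    intro i j
    refine hmul _ fun p r n f hf => ?_
    rw [← mul_assoc]
    fin_cases i <;> simp only [Fin.zero_eta, Fin.mk_one]
    · refine Submodule.subset_span ⟨p + 1, r, n, _, ?_, rfl⟩
      rw [pow_succ', mul_assoc]
      exact Submodule.mul_mem_mul (Submodule.subset_span ⟨j, rfl⟩) hf
    · refine Submodule.subset_span ⟨p, r + 1, n, _, ?_, rfl⟩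
      rw [pow_succ', ← mul_assoc]
      refine mul_le_mul_left (rowSpan_mul_pow_le h.toIsQuantumMatrix h.ne p) _ ?_
      rw [mul_assoc]
      exact Submodule.mul_mem_mul (Submodule.subset_span ⟨j, rfl⟩) hf
  have hδ : ∀ f ∈ Z, δ * f ∈ Z := by
    refine hmul _ fun p r n f hf => ?_
    have : Commute δ f := by
      have hc : ∀ i, ∀ g ∈ rowSpan x i, Commute δ g := by
        intro i g hg
        induction hg using Submodule.span_induction with
        | zero => exact Commute.zero_right _
        | add a b _ _ ha hb => exact ha.add_right hb
        | smul r a _ ha => exact ha.smul_right r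
        | mem b hb =>
          obtain ⟨j, rfl⟩ := hb
          exact h.inv_comm i j
      have hcp : ∀ i n, ∀ g ∈ rowSpan x i ^ n, Commute δ g := by
        intro i n g hg
        induction hg using Submodule.pow_induction_on_left' with
        | algebraMap r => exact (Algebra.commutes r δ).symm
        | add a b _ _ _ ha hb => exact ha.add_right hb
        | mem_mul m hm i a _ ha => exact (hc _ m hm).mul_right ha
      refine Submodule.mul_induction_on hf (fun a ha b hb => ?_) fun a b ha hb => ?_
      · exact (hcp _ _ a ha).mul_right (hcp _ _ b hb)
      · exact ha.add_right hb
    refine Submodule.subset_span ⟨p, r, n + 1, f, hf, ?_⟩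
    rw [← mul_assoc, this.eq, mul_assoc, pow_succ']
  have h1 : (1 : R) ∈ Z :=
    Submodule.subset_span ⟨0, 0, 0, 1, by simpa using ⟨1, map_one _⟩, by simp⟩
  have hall : ∀ g ∈ Algebra.adjoin ℂ ((Set.range fun p : Fin 2 × Fin 2 => x p.1 p.2) ∪ {δ}),
      ∀ f ∈ Z, g * f ∈ Z := by
    intro g hg
    induction hg using Algebra.adjoin_induction with
    | mem g hg =>
      obtain ⟨⟨i, j⟩, rfl⟩ | rfl := hg
      · exact hx i j
      · exact hδ
    | algebraMap r =>
      intro f hf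
      rw [← Algebra.smul_def]
      exact Submodule.smul_mem _ _ hf
    | add a b _ _ ha hb =>
      intro f hf
      rw [add_mul]
      exact add_mem (ha f hf) (hb f hf)
    | mul a b _ _ ha hb =>
      intro f hf
      rw [mul_assoc]
      exact ha _ (hb f hf)
  simpa using hall f (hgen ▸ trivial) 1 h1

end IsQuantumGL

section Torus

variable {G D : Type} [Ring G] [Algebra ℂ G] [CommRing D] [Algebra ℂ D] (πD : G →ₐ[ℂ] D)
  (ΔG : G →ₐ[ℂ] G ⊗[ℂ] G)

/-- The coaction of the torus is multiplicative. -/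
theorem leftCoact_mul (f g : G) :
    leftCoact πD ΔG (f * g) = leftCoact πD ΔG f * leftCoact πD ΔG g :=
  map_mul ((Algebra.TensorProduct.map πD (.id ℂ G)).comp ΔG) f g

theorem leftCoact_one :
    leftCoact πD ΔG 1 = 1 ⊗ₜ 1 :=
  map_one ((Algebra.TensorProduct.map πD (.id ℂ G)).comp ΔG)

variable {πD ΔG}

/-- Products of elements homogeneous for the coaction of the torus are homogeneous. -/
theorem leftCoact_mul_eq {a b : D} {f g : G} (hf : leftCoact πD ΔG f = a ⊗ₜ f)
    (hg : leftCoact πD ΔG g = b ⊗ₜ g) : leftCoact πD ΔG (f * g) = (a * b) ⊗ₜ (f * g) := by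
  rw [leftCoact_mul, hf, hg, Algebra.TensorProduct.tmul_mul_tmul]

end Torus

namespace IsQuantumGroup

variable {M G : Type} [Ring M] [Algebra ℂ M] [Ring G] [Algebra ℂ G] {q : ℂ}
  {x : Fin 2 → Fin 2 → M} {y : Fin 2 → Fin 2 → G} {δ : G} {ι : M →ₐ[ℂ] G}
  {ΔM : M →ₐ[ℂ] M ⊗[ℂ] M} {ΔG : G →ₐ[ℂ] G ⊗[ℂ] G} {εG : G →ₐ[ℂ] ℂ} {St : G →ₗ[ℂ] G}
  {D : Type} [CommRing D] [Algebra ℂ D] {t : Fin 2 → Dˣ} {πD : G →ₐ[ℂ] D}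

theorem leftCoact_entry (H : IsQuantumGroup q x y δ ι ΔM ΔG εG St)
    (hπ : ∀ i j, πD (y i j) = if i = j then (t i : D) else 0) (i j : Fin 2) :
    leftCoact πD ΔG (y i j) = (t i : D) ⊗ₜ y i j := by
  simp only [leftCoact, LinearMap.comp_apply, AlgHom.toLinearMap_apply, H.comul, map_sum,
    TensorProduct.map_tmul, LinearMap.id_apply, hπ]
  fin_cases i <;> simp

theorem leftCoact_inv (H : IsQuantumGroup q x y δ ι ΔM ΔG εG St)
    (hπ : ∀ i j, πD (y i j) = if i = j then (t i : D) else 0) :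
    leftCoact πD ΔG δ = (((t 0)⁻¹ * (t 1)⁻¹ : Dˣ) : D) ⊗ₜ δ := by
  have h1 : (t 0 * t 1 : D) * πD δ = 1 := by
    have := congrArg πD H.gl.det_mul
    simpa [det₂, hπ] using this
  have h2 : πD δ = (((t 0)⁻¹ * (t 1)⁻¹ : Dˣ) : D) := by
    rw [← mul_inv]
    exact (Units.inv_eq_of_mul_eq_one_right h1).symm
  simp only [leftCoact, LinearMap.comp_apply, AlgHom.toLinearMap_apply, H.comul_inv,
    TensorProduct.map_tmul, LinearMap.id_apply, h2]

theorem leftCoact_rowSpan_pow (H : IsQuantumGroup q x y δ ι ΔM ΔG εG St)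
    (hπ : ∀ i j, πD (y i j) = if i = j then (t i : D) else 0) (i : Fin 2) (n : ℕ) :
    ∀ f ∈ rowSpan y i ^ n, leftCoact πD ΔG f = ((t i : D) ^ n) ⊗ₜ f := by
  induction n with
  | zero =>
    intro f hf
    obtain ⟨r, rfl⟩ := Submodule.mem_one.1 (pow_zero (rowSpan y i) ▸ hf)
    rw [Algebra.algebraMap_eq_smul_one, map_smul, leftCoact_one, pow_zero,
      TensorProduct.tmul_smul]
  | succ n ih =>
    intro f hf
    rw [pow_succ] at hf
    rw [pow_succ]
    refine Submodule.mul_induction_on hf (fun a ha b hb => leftCoact_mul_eq (ih a ha) ?_)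
      fun a b ha hb => by rw [map_add, ha, hb, TensorProduct.tmul_add]
    induction hb using Submodule.span_induction with
    | zero => simp
    | add a b _ _ ha hb => rw [map_add, ha, hb, TensorProduct.tmul_add]
    | smul r a _ ha => rw [map_smul, ha, TensorProduct.tmul_smul]
    | mem b hb =>
      obtain ⟨j, rfl⟩ := hb
      exact H.leftCoact_entry hπ i j

theorem leftCoact_pow (H : IsQuantumGroup q x y δ ι ΔM ΔG εG St)
    (hπ : ∀ i j, πD (y i j) = if i = j then (t i : D) else 0) {p r n : ℕ} {f : G}
    (hf : f ∈ rowSpan y 0 ^ p * rowSpan y 1 ^ r) :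
    leftCoact πD ΔG (f * δ ^ n)
      = ((t 0 ^ p * t 1 ^ r * ((t 0)⁻¹ * (t 1)⁻¹) ^ n : Dˣ) : D) ⊗ₜ (f * δ ^ n) := by
  have hδ : leftCoact πD ΔG (δ ^ n) = ((((t 0)⁻¹ * (t 1)⁻¹) ^ n : Dˣ) : D) ⊗ₜ (δ ^ n) := by
    induction n with
    | zero => simpa using leftCoact_one πD ΔG
    | succ n ih =>
      rw [pow_succ, pow_succ, Units.val_mul]
      exact leftCoact_mul_eq ih (H.leftCoact_inv hπ)
  rw [Units.val_mul]
  refine leftCoact_mul_eq ?_ hδ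
  refine Submodule.mul_induction_on hf (fun a ha b hb => ?_)
    fun a b ha hb => by rw [map_add, ha, hb, TensorProduct.tmul_add]
  rw [Units.val_mul, Units.val_pow_eq_pow_val, Units.val_pow_eq_pow_val]
  exact leftCoact_mul_eq (H.leftCoact_rowSpan_pow hπ 0 p a ha)
    (H.leftCoact_rowSpan_pow hπ 1 r b hb)

/-- The coinvariants of the torus are generated by the elements `x_{1j} x_{2k} / det`. -/
theorem mem_dCoinv_iff (H : IsQuantumGroup q x y δ ι ΔM ΔG εG St)
    (hπ : ∀ i j, πD (y i j) = if i = j then (t i : D) else 0)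
    (hfree : ∀ (B : Type) [CommRing B] [Algebra ℂ B] (u : Fin 2 → Bˣ),
      ∃! φ : D →ₐ[ℂ] B, ∀ i, φ (t i : D) = (u i : B)) (f : G) :
    f ∈ dCoinv πD ΔG ↔ ∃ n, f ∈ torusInv y δ ^ n := by
  constructor
  · obtain ⟨κ, hκ1, hκ⟩ := exists_constantCoeff t hfree
    let L : G →ₗ[ℂ] G :=
      (TensorProduct.lid ℂ G).toLinearMap ∘ₗ TensorProduct.map κ LinearMap.id ∘ₗ leftCoact πD ΔG
    have hdir : Directed (· ≤ ·) fun n => torusInv y δ ^ n :=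
      (monotone_nat_of_le_succ fun n => IsQuantumGL.pow_le_succ n).directed_le
    have hL : ∀ (d : D) f, leftCoact πD ΔG f = d ⊗ₜ f → L f = κ d • f := by
      intro d f hf
      simp only [L, LinearMap.comp_apply, hf, TensorProduct.map_tmul, LinearMap.id_apply,
        LinearEquiv.coe_coe, TensorProduct.lid_tmul]
    intro hf
    rw [← Submodule.mem_iSup_of_directed _ hdir]
    suffices f ∈ (⨆ n, torusInv y δ ^ n).comap L by
      rwa [Submodule.mem_comap, hL 1 f hf, hκ1, one_smul] at this
    refine H.gl.induction_rowSpan H.genG _ (fun p r n g hg => ?_) f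
    rw [Submodule.mem_comap, hL _ _ (H.leftCoact_pow hπ hg)]
    by_cases h0 : κ ((t 0 ^ p * t 1 ^ r * ((t 0)⁻¹ * (t 1)⁻¹) ^ n : Dˣ) : D) = 0
    · rw [h0, zero_smul]
      exact zero_mem _
    · obtain ⟨rfl, rfl⟩ := hκ p r n h0
      exact Submodule.smul_mem _ _ (Submodule.mem_iSup_of_mem _
        (H.gl.rowSpan_le_torusInv_pow _ g hg))
  · rintro ⟨n, hn⟩
    have hgen : ∀ g ∈ torusInv y δ, leftCoact πD ΔG g = 1 ⊗ₜ g := by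
      intro g hg
      induction hg using Submodule.span_induction with
      | zero => simp
      | add a b _ _ ha hb => rw [map_add, ha, hb, TensorProduct.tmul_add]
      | smul r a _ ha => rw [map_smul, ha, TensorProduct.tmul_smul]
      | mem g hg =>
        obtain rfl | ⟨⟨j, k⟩, rfl⟩ := hg
        · exact leftCoact_one _ _
        · rw [leftCoact_mul_eq (leftCoact_mul_eq (H.leftCoact_entry hπ 0 j)
            (H.leftCoact_entry hπ 1 k)) (H.leftCoact_inv hπ), ← Units.val_mul, ← Units.val_mul,
            ← mul_inv, mul_inv_cancel, Units.val_one]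
    change leftCoact πD ΔG f = 1 ⊗ₜ f
    induction hn using Submodule.pow_induction_on_left' with
    | algebraMap r =>
      rw [Algebra.algebraMap_eq_smul_one, map_smul, leftCoact_one, TensorProduct.tmul_smul]
    | add a b _ _ _ ha hb => rw [map_add, ha, hb, TensorProduct.tmul_add]
    | mem_mul m hm i a _ ha => simpa using leftCoact_mul_eq (hgen m hm) ha

end IsQuantumGroup

theorem qdet_eq_det₂ {R : Type} [Ring R] [Algebra ℂ R] (q : ℂ) (x : Fin 2 → Fin 2 → R) :
    qdet q x = det₂ q x := by
  have hf : ∀ k : Fin (Finset.univ : Finset (Fin 2)).card,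
      ((Finset.univ : Finset (Fin 2)).orderIsoOfFin rfl k).1 = k := by
    have h := Finset.orderEmbOfFin_unique (s := (Finset.univ : Finset (Fin 2))) (k := 2) rfl
      (f := id) (fun _ => Finset.mem_univ _) strictMono_id
    intro k
    exact (congrFun h k).symm
  simp only [qdet, qMinor, hf]
  change ∑ σ : Equiv.Perm (Fin 2), ((-q) ^ invCount σ) •
    ((List.finRange 2).map fun k => x k (σ k)).prod = _
  have hu : (Finset.univ : Finset (Equiv.Perm (Fin 2))) = {1, Equiv.swap 0 1} := by decide
  have h1 : invCount (1 : Equiv.Perm (Fin 2)) = 0 := by decide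
  have h2 : invCount (Equiv.swap 0 1 : Equiv.Perm (Fin 2)) = 1 := by decide
  rw [hu, Finset.sum_pair (by decide), h1, h2]
  simp [List.finRange_succ, det₂, sub_eq_add_neg]

theorem isQuantumMatrix_of_relations {R : Type} [Ring R] [Algebra ℂ R] {q : ℂ} (hq : q ≠ 0)
    {x : Fin 2 → Fin 2 → R}
    (hrow : ∀ i j l : Fin 2, j < l → x i j * x i l = q • (x i l * x i j))
    (hcol : ∀ i k j : Fin 2, i < k → x i j * x k j = q • (x k j * x i j))
    (hanti : ∀ i k j l : Fin 2, i < k → j < l → x i l * x k j = x k j * x i l)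
    (hdiag : ∀ i k j l : Fin 2, i < k → j < l →
      x i j * x k l - x k l * x i j = (q - q⁻¹) • (x i l * x k j)) : IsQuantumMatrix q x where
  ab := hrow 0 0 1 (by decide)
  ac := hcol 0 1 0 (by decide)
  cb := (hanti 0 1 0 1 (by decide) (by decide)).symm
  db := by rw [hcol 0 1 1 (by decide), inv_smul_smul₀ hq]
  dc := by rw [hrow 1 0 1 (by decide), inv_smul_smul₀ hq]
  da := by rw [← hdiag 0 1 0 1 (by decide) (by decide), sub_sub_cancel]

namespace IsQuantumMatrix

variable {R : Type} [Ring R] [Algebra ℂ R] {q : ℂ} {x : Fin 2 → Fin 2 → R}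

theorem row (h : IsQuantumMatrix q x) (hq : q ≠ 0) :
    ∀ i j l : Fin 2, j < l → x i j * x i l = q • (x i l * x i j) := by
  intro i j l hjl
  obtain ⟨rfl, rfl⟩ : j = 0 ∧ l = 1 := by lia
  fin_cases i
  · exact h.ab
  · exact ((congrArg (q • ·) h.dc).trans (smul_inv_smul₀ hq _)).symm

theorem col (h : IsQuantumMatrix q x) (hq : q ≠ 0) :
    ∀ i k j : Fin 2, i < k → x i j * x k j = q • (x k j * x i j) := by
  intro i k j hik
  obtain ⟨rfl, rfl⟩ : i = 0 ∧ k = 1 := by lia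
  fin_cases j
  · exact h.ac
  · exact ((congrArg (q • ·) h.db).trans (smul_inv_smul₀ hq _)).symm

theorem anti (h : IsQuantumMatrix q x) :
    ∀ i k j l : Fin 2, i < k → j < l → x i l * x k j = x k j * x i l := by
  intro i k j l hik hjl
  obtain ⟨⟨rfl, rfl⟩, rfl, rfl⟩ : (i = 0 ∧ k = 1) ∧ j = 0 ∧ l = 1 := by lia
  exact h.cb.symm

theorem diag (h : IsQuantumMatrix q x) : ∀ i k j l : Fin 2, i < k → j < l →
    x i j * x k l - x k l * x i j = (q - q⁻¹) • (x i l * x k j) := by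
  intro i k j l hik hjl
  obtain ⟨⟨rfl, rfl⟩, rfl, rfl⟩ : (i = 0 ∧ k = 1) ∧ j = 0 ∧ l = 1 := by lia
  rw [h.da, sub_sub_cancel]

end IsQuantumMatrix

/-- The powers of the span of `1` and a set `s` are spanned by the words in `s`. -/
theorem span_insert_one_pow {R : Type} [Ring R] [Algebra ℂ R] (s : Set R) (n : ℕ) :
    Submodule.span ℂ ({1} ∪ s) ^ n
      = Submodule.span ℂ {f | ∃ l : List R, (∀ z ∈ l, z ∈ s) ∧ l.length ≤ n ∧ f = l.prod} := by
  induction n with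
  | zero =>
    rw [pow_zero, Submodule.one_eq_span]
    congr 1
    ext f
    constructor
    · rintro rfl
      exact ⟨[], by simp, le_rfl, rfl⟩
    · rintro ⟨l, -, hl, rfl⟩
      rw [List.length_eq_zero_iff.1 (Nat.le_zero.1 hl)]
      rfl
  | succ n ih =>
    rw [pow_succ', ih, Submodule.span_mul_span]
    congr 1
    ext f
    constructor
    · rintro ⟨g, rfl | hg, _, ⟨l, hs, hl, rfl⟩, rfl⟩
      · exact ⟨l, hs, hl.trans n.le_succ, one_mul _⟩
      · exact ⟨g :: l, by simpa using ⟨hg, hs⟩, by simpa using hl, List.prod_cons.symm⟩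
    · rintro ⟨l, hs, hl, rfl⟩
      rcases l with _ | ⟨g, l⟩
      · exact ⟨1, Or.inl rfl, 1, ⟨[], by simp, Nat.zero_le n, rfl⟩, one_mul 1⟩
      · rw [List.forall_mem_cons] at hs
        exact ⟨g, Or.inr hs.1, l.prod, ⟨l, hs.2, by simpa using hl, rfl⟩, List.prod_cons.symm⟩

theorem torusInv_eq_span {R : Type} [Ring R] [Algebra ℂ R] {q : ℂ} {x : Fin 2 → Fin 2 → R} {δ : R}
    (h : IsQuantumGL q x δ) : torusInv x δ = Submodule.span ℂ ({1} ∪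
      {z | z = x 0 0 * x 1 0 * δ ∨ z = x 0 1 * x 1 0 * δ ∨ z = x 0 1 * x 1 1 * δ}) := by
  have hmem := @Submodule.subset_span ℂ R _ _ _ ({1} ∪
      {z | z = x 0 0 * x 1 0 * δ ∨ z = x 0 1 * x 1 0 * δ ∨ z = x 0 1 * x 1 1 * δ})
  refine le_antisymm (Submodule.span_le.2 ?_) (Submodule.span_le.2 ?_)
  · rintro _ (rfl | ⟨⟨j, k⟩, rfl⟩)
    · exact hmem (Or.inl rfl)
    · have hv := hmem (Or.inr (Or.inr (Or.inl rfl)))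
      fin_cases j <;> fin_cases k
      · exact hmem (Or.inr (Or.inl rfl))
      · have : x 0 0 * x 1 1 * δ = 1 + q • (x 0 1 * x 1 0 * δ) := by
          rw [← h.det_mul, det₂, sub_mul, smul_mul_assoc, sub_add_cancel]
        simp only [Fin.zero_eta, Fin.mk_one, this]
        exact add_mem (hmem (Or.inl rfl)) (Submodule.smul_mem _ _ hv)
      · exact hv
      · exact hmem (Or.inr (Or.inr (Or.inr rfl)))
  · rintro _ (rfl | rfl | rfl | rfl)
    · exact IsQuantumGL.one_mem_torusInv
    · exact IsQuantumGL.mem_torusInv 0 0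
    · exact IsQuantumGL.mem_torusInv 1 0
    · exact IsQuantumGL.mem_torusInv 1 1

namespace IsQuantumGroup

variable {M G : Type} [Ring M] [Algebra ℂ M] [Ring G] [Algebra ℂ G] {q : ℂ}
  {x : Fin 2 → Fin 2 → M} {y : Fin 2 → Fin 2 → G} {δ : G} {ι : M →ₐ[ℂ] G}
  {ΔM : M →ₐ[ℂ] M ⊗[ℂ] M} {ΔG : G →ₐ[ℂ] G ⊗[ℂ] G} {εG : G →ₐ[ℂ] ℂ} {St : G →ₗ[ℂ] G}
  {ξ : Fin 2 → ℂ} {e : M →ₐ[ℂ] ℂ}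

theorem map_coorbit_entries_pow (H : IsQuantumGroup q x y δ ι ΔM ΔG εG St)
    (he : ∀ i j, e (x i j) = if i = j then ξ i else 0) (n : ℕ)
    (hξ : ∀ k, 1 ≤ k → k ≤ n → ξ 0 - (q ^ (2 * k))⁻¹ * ξ 1 ≠ 0) :
    (entries x ^ n).map (coorbit e (adjAlpha ΔM ι St)) = torusInv y δ ^ n := by
  refine map_entries_pow H.gl H.coorbit_one (H.coorbit_mul_eq_conj he) (fun i => ?_) n hξ
  fin_cases i
  · exact one_ne_zero
  · exact neg_ne_zero.2 H.gl.ne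

/-- An element of the degree `n` part killed by the co-orbit map lies in the ideal of the
coinvariants, as soon as the co-orbit map has maximal rank in degree `n`. -/
theorem mem_sup_of_coorbit_eq_zero (H : IsQuantumGroup q x y δ ι ΔM ΔG εG St)
    (he : ∀ i j, e (x i j) = if i = j then ξ i else 0) {n : ℕ}
    (hξ : ∀ k, 1 ≤ k → k ≤ n → ξ 0 - (q ^ (2 * k))⁻¹ * ξ 1 ≠ 0) {K : Submodule ℂ M}
    (hK : coinvIdeal q x e ≤ K) (hK' : K ≤ LinearMap.ker (coorbit e (adjAlpha ΔM ι St))) {f : M}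
    (hf : f ∈ K ⊔ entries x ^ n) (h0 : coorbit e (adjAlpha ΔM ι St) f = 0) : f ∈ K := by
  have := normalMonomials.finite (x := x) n
  have hE : entries x ^ n ≤ K ⊔ normalMonomials x n :=
    (H.mat.entries_pow_le_sup e n).trans (sup_le_sup_right hK _)
  exact mem_of_map_eq_zero _ hK' ((normalMonomials.finrank_le n).trans (H.sq_le_finrank_torusInv n))
    (H.map_coorbit_entries_pow he n hξ).ge hE (sup_le le_sup_left hE hf) h0

theorem ker_coorbit (H : IsQuantumGroup q x y δ ι ΔM ΔG εG St)
    (he : ∀ i j, e (x i j) = if i = j then ξ i else 0)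
    (hξ : ∀ k, 1 ≤ k → ξ 0 - (q ^ (2 * k))⁻¹ * ξ 1 ≠ 0) :
    LinearMap.ker (coorbit e (adjAlpha ΔM ι St)) = coinvIdeal q x e := by
  refine le_antisymm (fun f hf => ?_) H.coinvIdeal_le_ker
  obtain ⟨n, hn⟩ := entries.exists_mem H.gen f
  exact H.mem_sup_of_coorbit_eq_zero he (fun k hk _ => hξ k hk) le_rfl H.coinvIdeal_le_ker
    (le_sup_right (a := coinvIdeal q x e) hn) hf

theorem mem_range_coorbit_iff (H : IsQuantumGroup q x y δ ι ΔM ΔG εG St)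
    (he : ∀ i j, e (x i j) = if i = j then ξ i else 0)
    (hξ : ∀ k, 1 ≤ k → ξ 0 - (q ^ (2 * k))⁻¹ * ξ 1 ≠ 0) (f : G) :
    f ∈ Set.range (coorbit e (adjAlpha ΔM ι St)) ↔ ∃ n, f ∈ torusInv y δ ^ n := by
  have hmap := fun n => H.map_coorbit_entries_pow he n fun k hk _ => hξ k hk
  constructor
  · rintro ⟨g, rfl⟩
    obtain ⟨n, hn⟩ := entries.exists_mem H.gen g
    exact ⟨n, hmap n ▸ Submodule.mem_map_of_mem hn⟩
  · rintro ⟨n, hn⟩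
    rw [← hmap n] at hn
    obtain ⟨g, -, rfl⟩ := hn
    exact ⟨g, rfl⟩

theorem range_coorbit (H : IsQuantumGroup q x y δ ι ΔM ΔG εG St)
    (he : ∀ i j, e (x i j) = if i = j then ξ i else 0) {m : ℕ}
    (hξ : ∀ k, 1 ≤ k → k ≤ m → ξ 0 - (q ^ (2 * k))⁻¹ * ξ 1 ≠ 0)
    (hξ' : ξ 0 - (q ^ (2 * m + 2))⁻¹ * ξ 1 = 0) :
    LinearMap.range (coorbit e (adjAlpha ΔM ι St)) = torusInv y δ ^ m := by
  refine le_antisymm ?_ ?_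
  · rintro _ ⟨g, rfl⟩
    obtain ⟨n, hn⟩ := entries.exists_mem H.gen g
    exact map_entries_pow_le_of_eq_zero H.gl H.coorbit_one (H.coorbit_mul_eq_conj he) hξ' n
      (Submodule.mem_map_of_mem hn)
  · rw [← H.map_coorbit_entries_pow he m hξ]
    exact LinearMap.map_le_range

theorem ker_coorbit_of_eq_zero (H : IsQuantumGroup q x y δ ι ΔM ΔG εG St)
    (hq : (∀ n : ℕ, 0 < n → q ^ n ≠ 1) ∨ q = 1)
    (he : ∀ i j, e (x i j) = if i = j then ξ i else 0) {m : ℕ}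
    (hξ : ∀ k, 1 ≤ k → k ≤ m → ξ 0 - (q ^ (2 * k))⁻¹ * ξ 1 ≠ 0)
    (hξ' : ξ 0 - (q ^ (2 * m + 2))⁻¹ * ξ 1 = 0) :
    LinearMap.ker (coorbit e (adjAlpha ΔM ι St))
      = coinvIdeal q x e ⊔
        comodGen (adjAlpha ΔM ι St) {f : M | ∃ k : ℕ, m < k ∧ f = x 1 0 ^ k} := by
  have hle : coinvIdeal q x e ⊔ comodGen (adjAlpha ΔM ι St)
      {f : M | ∃ k : ℕ, m < k ∧ f = x 1 0 ^ k} ≤ LinearMap.ker (coorbit e (adjAlpha ΔM ι St)) :=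
    sup_le H.coinvIdeal_le_ker (H.comodGen_le_ker he hξ')
  refine le_antisymm (fun f hf => ?_) hle
  obtain ⟨n, hn⟩ := entries.exists_mem H.gen f
  exact H.mem_sup_of_coorbit_eq_zero he hξ le_sup_left hle
    (H.entries_pow_le_of_comodGen hq e m n hn) hf

end IsQuantumGroup

/-- `N = 2`, `q` not a root of unity, `ξ = diag(ξ₁, ξ₂)`: image and kernel of the
co-orbit map `α^ξ`, in the non-degenerate case (i') and the degenerate case (ii'). -/
theorem image_and_ker_coorbit_alpha_2x2
    (q : ℂ) (hq : q ≠ 0) (hqru : (∀ n : ℕ, 0 < n → q ^ n ≠ 1) ∨ q = 1)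
    (M G : Type) [Ring M] [Algebra ℂ M] [Ring G] [Algebra ℂ G]
    (x : Fin 2 → Fin 2 → M)
    (hrow : ∀ i j l : Fin 2, j < l → x i j * x i l = (q) • (x i l * x i j))
    (hcol : ∀ i k j : Fin 2, i < k → x i j * x k j = (q) • (x k j * x i j))
    (hanti : ∀ i k j l : Fin 2, i < k → j < l → x i l * x k j = x k j * x i l)
    (hdiag : ∀ i k j l : Fin 2, i < k → j < l →
      x i j * x k l - x k l * x i j = ((q) - (q⁻¹)) • (x i l * x k j))
    (hgen : Algebra.adjoin ℂ (Set.range fun p : Fin 2 × Fin 2 => x p.1 p.2) = ⊤)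
    (hfree : ∀ (B : Type) [Ring B] [Algebra ℂ B] (y : Fin 2 → Fin 2 → B),
      (∀ i j l : Fin 2, j < l → y i j * y i l = (q) • (y i l * y i j)) →
      (∀ i k j : Fin 2, i < k → y i j * y k j = (q) • (y k j * y i j)) →
      (∀ i k j l : Fin 2, i < k → j < l → y i l * y k j = y k j * y i l) →
      (∀ i k j l : Fin 2, i < k → j < l →
        y i j * y k l - y k l * y i j = ((q) - (q⁻¹)) • (y i l * y k j)) →
      ∃! φ : M →ₐ[ℂ] B, ∀ i j, φ (x i j) = y i j)
    (ι : M →ₐ[ℂ] G) (dInv : G)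
    (hd1 : ι (qdet (q) x) * dInv = 1)
    (hd2 : dInv * ι (qdet (q) x) = 1)
    (hgenG : Algebra.adjoin ℂ
      (Set.range (fun p : Fin 2 × Fin 2 => ι (x p.1 p.2)) ∪ {dInv}) = ⊤)
    (hfreeG : ∀ (B : Type) [Ring B] [Algebra ℂ B] (φ : M →ₐ[ℂ] B) (u : B),
      φ (qdet (q) x) * u = 1 → u * φ (qdet (q) x) = 1 →
      ∃! ψ : G →ₐ[ℂ] B, ψ.comp ι = φ)
    (ΔM : M →ₐ[ℂ] M ⊗[ℂ] M)
    (hΔM : ∀ i j, ΔM (x i j) = ∑ k, x i k ⊗ₜ[ℂ] x k j)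
    (ΔG : G →ₐ[ℂ] G ⊗[ℂ] G)
    (hΔG : ∀ m, ΔG (ι m) = Algebra.TensorProduct.map ι ι (ΔM m))
    (εG : G →ₐ[ℂ] ℂ)
    (hεG : ∀ i j, εG (ι (x i j)) = if i = j then 1 else 0)
    (St : G →ₗ[ℂ] G)
    (hS1 : LinearMap.mul' ℂ G ∘ₗ TensorProduct.map St LinearMap.id ∘ₗ ΔG.toLinearMap
      = Algebra.linearMap ℂ G ∘ₗ εG.toLinearMap)
    (hS2 : LinearMap.mul' ℂ G ∘ₗ TensorProduct.map LinearMap.id St ∘ₗ ΔG.toLinearMap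
      = Algebra.linearMap ℂ G ∘ₗ εG.toLinearMap)
    (D : Type) [CommRing D] [Algebra ℂ D]
    (t : Fin 2 → (D)ˣ)
    (πD : G →ₐ[ℂ] D)
    (hπD : ∀ i j, πD (ι (x i j)) = if i = j then (t i : D) else 0)
    (hfreeD : ∀ (B : Type) [CommRing B] [Algebra ℂ B] (u : Fin 2 → Bˣ),
      ∃! φ : D →ₐ[ℂ] B, ∀ i, φ (t i : D) = (u i : B))
    (ξ1 ξ2 : ℂ) (e : M →ₐ[ℂ] ℂ)
    (he00 : e (x 0 0) = ξ1) (he01 : e (x 0 1) = 0)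
    (he10 : e (x 1 0) = 0) (he11 : e (x 1 1) = ξ2) :
    ((∀ k : ℕ, 1 ≤ k → ξ1 - (q ^ (2 * k))⁻¹ * ξ2 ≠ 0) →
      Set.range ⇑(coorbit e (adjAlpha ΔM ι St)) = dCoinv πD ΔG
      ∧ LinearMap.ker (coorbit e (adjAlpha ΔM ι St))
          = Submodule.span ℂ {y : M | ∃ h : M,
              y = h * ((x 0 0 + x 1 1) - algebraMap ℂ M (e (x 0 0 + x 1 1))) ∨
              y = h * ((x 0 0 * x 1 1 - q • (x 0 1 * x 1 0)) - algebraMap ℂ M (e (x 0 0 * x 1 1 - q • (x 0 1 * x 1 0))))})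
    ∧ (∀ m : ℕ, (∀ k : ℕ, 1 ≤ k → k ≤ m → ξ1 - (q ^ (2 * k))⁻¹ * ξ2 ≠ 0) →
      ξ1 - (q ^ (2 * m + 2))⁻¹ * ξ2 = 0 →
      LinearMap.range (coorbit e (adjAlpha ΔM ι St))
          = Submodule.span ℂ {y : G | ∃ l : List G,
        (∀ z ∈ l, z = ι (x 0 0) * ι (x 1 0) * dInv ∨ z = ι (x 0 1) * ι (x 1 0) * dInv ∨
          z = ι (x 0 1) * ι (x 1 1) * dInv) ∧ l.length ≤ m ∧ y = l.prod}
      ∧ LinearMap.ker (coorbit e (adjAlpha ΔM ι St))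
          = Submodule.span ℂ {y : M | ∃ h : M,
              y = h * ((x 0 0 + x 1 1) - algebraMap ℂ M (e (x 0 0 + x 1 1))) ∨
              y = h * ((x 0 0 * x 1 1 - q • (x 0 1 * x 1 0)) - algebraMap ℂ M (e (x 0 0 * x 1 1 - q • (x 0 1 * x 1 0))))}
            ⊔ comodGen (adjAlpha ΔM ι St) {y : M | ∃ k : ℕ, m < k ∧ y = x 1 0 ^ k}) := by
  have hdet := qdet_eq_det₂ q x
  have hmat : IsQuantumMatrix q x := isQuantumMatrix_of_relations hq hrow hcol hanti hdiag
  have hιmat : IsQuantumMatrix q fun i j => ι (x i j) :=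
    { ab := by simp only [← map_mul, ← map_smul, hmat.ab]
      ac := by simp only [← map_mul, ← map_smul, hmat.ac]
      cb := by simp only [← map_mul, hmat.cb]
      db := by simp only [← map_mul, ← map_smul, hmat.db]
      dc := by simp only [← map_mul, ← map_smul, hmat.dc]
      da := by simp only [← map_mul, ← map_smul, ← map_sub, hmat.da] }
  have hιdet : det₂ q (fun i j => ι (x i j)) = ι (qdet q x) := by
    simp only [hdet, det₂, map_sub, map_mul, map_smul]
  have H : IsQuantumGroup q x (fun i j => ι (x i j)) dInv ι ΔM ΔG εG St :=
    { mat := hmat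
      gl := { hιmat with
        ne := hq
        det_mul := by rw [hιdet, hd1]
        mul_det := by rw [hιdet, hd2] }
      map := fun _ _ => rfl
      gen := hgen
      genG := hgenG
      comulM := hΔM
      comul_map := hΔG
      counit := hεG
      antipode_mul_id := hS1
      id_mul_antipode := hS2
      lift := fun B _ _ z hz hz1 => by
        obtain ⟨φ, hφ, -⟩ := hfree B z (hz.row hq) (hz.col hq) hz.anti hz.diag
        have hφdet : φ (qdet q x) = 1 := by
          rw [hdet, ← hz1]
          simp only [det₂, map_sub, map_mul, map_smul, hφ]
        obtain ⟨ψ, hψ, -⟩ := hfreeG B φ 1 (by rw [hφdet, mul_one]) (by rw [hφdet, mul_one])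
        exact ⟨ψ, fun i j => (congr($hψ (x i j))).trans (hφ i j)⟩ }
  have he : ∀ i j, e (x i j) = if i = j then (![ξ1, ξ2] : Fin 2 → ℂ) i else 0 := by
    intro i j
    fin_cases i <;> fin_cases j <;> simp [he00, he01, he10, he11]
  refine ⟨fun hξ => ⟨?_, H.ker_coorbit he hξ⟩, fun m hξ hξ' =>
    ⟨?_, H.ker_coorbit_of_eq_zero hqru he hξ hξ'⟩⟩
  · ext f
    rw [H.mem_range_coorbit_iff he hξ, H.mem_dCoinv_iff hπD hfreeD]
  · rw [H.range_coorbit he hξ hξ', torusInv_eq_span H.gl, span_insert_one_pow]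
    rfl
end
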